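/- arXiv:2604.06516 — 4 statements merged into one kernel-verified Lean document; each statement's English description precedes it below -/
import Mathlib

section
/- For every a ∈ ℝ: the set Ω_a is open in [0,∞)×ℝ (for the relative topology); u_a is bounded above locally in t and globally in x, indeed u_a(t,x) ≤ β̄ + t·R̄ + t·sup_{x,v}(−L(x,v))⁺ ≤ β̄ + t·R̄ for all (t,x) (since L ≥ 0); and u_a is locally Lipschitz continuous on Ω̃_a. -/
open MeasureTheory Real Filter Set

noncomputable def Hfun (G : ℝ → ℝ) (α : ℝ) : ℝ := ∫ y : ℝ, (Real.exp (α * y) - 1) * G y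

/-- `L(x,v) = sup_{α ∈ ℝ} (α v − p(x) H(α))`. -/
noncomputable def Lfun (G p : ℝ → ℝ) (x v : ℝ) : ℝ := ⨆ α : ℝ, (α * v - p x * Hfun G α)

/-- growth rate `R = b + p − d`. -/
noncomputable def Rfun (b p d : ℝ → ℝ) (x : ℝ) : ℝ := b x + p x - d x

/-- `F_s(f) = β₀(f(0)) + ∫₀ˢ R(f(u)) du − I_s(f)` (real-valued formula, used for paths
with finite rate function `I`). -/
noncomputable def Ffun (G p b d β₀ : ℝ → ℝ) (f f' : ℝ → ℝ) (s : ℝ) : ℝ :=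
  β₀ (f 0) + (∫ u in (0 : ℝ)..s, Rfun b p d (f u)) -
    ∫ u in (0 : ℝ)..s, Lfun G p (f u) (f' u)

/-- `f` (with integrable a.e. derivative `f'`) is admissible in the variational problem
defining `u_a(t,x)`: it is absolutely continuous on `[0,t]`, has finite rate function
`I_t(f)` (paths with `I_s(f) = +∞` for some `s ≤ t` have `F_s(f) = −∞ < a`, hence are
never admissible), ends at `x` at time `t`, and satisfies the state constraint
`F_s(f) ≥ a` for all `s ∈ [0,t]`. -/
structure Admissible (G p b d β₀ : ℝ → ℝ) (a t x : ℝ) (f f' : ℝ → ℝ) : Prop where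
  int_f' : IntegrableOn f' (Icc 0 t)
  ac : ∀ s ∈ Icc (0 : ℝ) t, f s = f 0 + ∫ u in (0 : ℝ)..s, f' u
  int_L : IntegrableOn (fun u => Lfun G p (f u) (f' u)) (Icc 0 t)
  endpoint : f t = x
  constraint : ∀ s ∈ Icc (0 : ℝ) t, a ≤ Ffun G p b d β₀ f f' s

/-- `u_a(t,x) ∈ [−∞,∞]` as the supremum of `F_t(f)` over admissible paths
(`sup ∅ = ⊥ = −∞`). -/
noncomputable def uval (G p b d β₀ : ℝ → ℝ) (a t x : ℝ) : EReal :=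
  sSup {z : EReal | ∃ f f' : ℝ → ℝ, Admissible G p b d β₀ a t x f f' ∧
    z = (Ffun G p b d β₀ f f' t : EReal)}

/-- `Ω̃_a = {(t,x) ∈ [0,∞)×ℝ : the admissible set is nonempty}`. -/
def OmTilde (G p b d β₀ : ℝ → ℝ) (a : ℝ) : Set (ℝ × ℝ) :=
  {q | 0 ≤ q.1 ∧ ∃ f f' : ℝ → ℝ, Admissible G p b d β₀ a q.1 q.2 f f'}

/-- `Ω_a = {(t,x) ∈ Ω̃_a : u_a(t,x) > a}`. -/
def Om (G p b d β₀ : ℝ → ℝ) (a : ℝ) : Set (ℝ × ℝ) :=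
  {q | q ∈ OmTilde G p b d β₀ a ∧ (a : EReal) < uval G p b d β₀ a q.1 q.2}


lemma aux_sinh (l x : ℝ) (hl : 1 ≤ l) (hx : 0 ≤ x) : l * Real.sinh x ≤ Real.sinh (l * x) := by
  have hd : ∀ y, HasDerivAt (fun y => Real.sinh (l * y) - l * Real.sinh y)
      (Real.cosh (l * y) * (l * 1) - l * Real.cosh y) y := fun y =>
    (((hasDerivAt_id y).const_mul l).sinh).sub ((Real.hasDerivAt_sinh y).const_mul l)
  have hm : Monotone (fun y => Real.sinh (l * y) - l * Real.sinh y) := by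
    apply monotone_of_deriv_nonneg (fun y => (hd y).differentiableAt)
    intro y
    rw [(hd y).deriv]
    have : Real.cosh y ≤ Real.cosh (l * y) := by
      rw [Real.cosh_le_cosh, abs_mul, abs_of_nonneg (by linarith : 0 ≤ l)]
      nlinarith [abs_nonneg y]
    nlinarith
  have := hm hx
  simp at this
  linarith

lemma aux_cosh (l x : ℝ) (hl : 1 ≤ l) :
    l ^ 2 * (Real.cosh x - 1) ≤ Real.cosh (l * x) - 1 := by
  have key : ∀ x : ℝ, 0 ≤ x → l ^ 2 * (Real.cosh x - 1) ≤ Real.cosh (l * x) - 1 := by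
    intro x hx
    have e : ∀ z : ℝ, Real.cosh z - 1 = 2 * Real.sinh (z / 2) ^ 2 := by
      intro z
      have := Real.cosh_two_mul (z / 2)
      rw [Real.cosh_sq, show 2 * (z / 2) = z by ring] at this
      linarith
    rw [e, e]
    have h1 := aux_sinh l (x / 2) hl (by linarith)
    have h2 : 0 ≤ Real.sinh (x / 2) := Real.sinh_nonneg_iff.2 (by linarith)
    rw [show l * x / 2 = l * (x / 2) by ring]
    have h3 : (l * Real.sinh (x / 2)) ^ 2 ≤ Real.sinh (l * (x / 2)) ^ 2 := by
      gcongr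
    nlinarith
  rcases le_total 0 x with hx | hx
  · exact key x hx
  · have := key (-x) (by linarith)
    rwa [Real.cosh_neg, mul_neg, Real.cosh_neg] at this

lemma Hfun_cosh (G : ℝ → ℝ) (hGeven : ∀ y, G (-y) = G y) (hGint : Integrable G)
    (hGexp : ∀ α : ℝ, Integrable (fun y => Real.exp (α * y) * G y)) (α : ℝ) :
    Integrable (fun y => (Real.cosh (α * y) - 1) * G y) ∧
    Hfun G α = ∫ y, (Real.cosh (α * y) - 1) * G y := by
  have hi : ∀ α, Integrable (fun y => (Real.exp (α * y) - 1) * G y) := by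
    intro α
    refine ((hGexp α).sub hGint).congr (ae_of_all _ fun y => ?_)
    simp; ring
  have hneg : Hfun G (-α) = Hfun G α := by
    unfold Hfun
    rw [← integral_neg_eq_self (fun y => (Real.exp (α * y) - 1) * G y)]
    congr 1; ext y
    rw [hGeven]; simp
  have he : (fun y => (Real.cosh (α * y) - 1) * G y) = fun y =>
      (1/2) * ((Real.exp (α * y) - 1) * G y + (Real.exp (-α * y) - 1) * G y) := by
    ext y
    rw [Real.cosh_eq]; ring_nf
  rw [he]
  refine ⟨((hi α).add (hi (-α))).const_mul _, ?_⟩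
  rw [integral_const_mul, integral_add (hi α) (hi (-α))]
  change _ = 1/2 * (Hfun G α + Hfun G (-α))
  rw [hneg]; ring

/-- the properties of `H` that we use -/
structure HP (H : ℝ → ℝ) : Prop where
  zero : H 0 = 0
  nonneg : ∀ α, 0 ≤ H α
  even : ∀ α, H (-α) = H α
  scale : ∀ l α, 1 ≤ l → l ^ 2 * H α ≤ H (l * α)
  one : 0 < H 1

lemma Hfun_HP (G : ℝ → ℝ)
    (hGcont : Continuous G) (hGpos : ∀ y, 0 < G y) (hGeven : ∀ y, G (-y) = G y)
    (hGint : Integrable G)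
    (hGexp : ∀ α : ℝ, Integrable (fun y => Real.exp (α * y) * G y)) : HP (Hfun G) := by
  have hc := Hfun_cosh G hGeven hGint hGexp
  refine ⟨?_, ?_, ?_, ?_, ?_⟩
  · simp [Hfun]
  · intro α
    rw [(hc α).2]
    exact integral_nonneg fun y => mul_nonneg (by linarith [Real.one_le_cosh (α * y)]) (hGpos y).le
  · intro α
    rw [(hc α).2, (hc (-α)).2]
    simp
  · intro l α hl
    rw [(hc α).2, (hc (l * α)).2, ← integral_const_mul]
    apply integral_mono ((hc α).1.const_mul _) (hc (l * α)).1
    intro y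
    have := aux_cosh l (α * y) hl
    have h2 := mul_le_mul_of_nonneg_right this (hGpos y).le
    simp only
    rw [mul_assoc l α y]
    linarith
  · rw [(hc 1).2]
    refine integral_pos_of_integrable_nonneg_nonzero (x := 1) ?_ (hc 1).1 ?_ ?_
    · fun_prop
    · exact fun y => mul_nonneg (by simp) (hGpos y).le
    · have h1 : 1 < Real.cosh (1 * 1) := Real.one_lt_cosh.2 (by norm_num)
      exact (mul_pos (by linarith) (hGpos 1)).ne'

noncomputable def Lq (H : ℝ → ℝ) (q v : ℝ) : ℝ := ⨆ α : ℝ, (α * v - q * H α)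

lemma Lq_bdd {H : ℝ → ℝ} (hH : HP H) {q : ℝ} (hq : 0 < q) (v : ℝ) :
    BddAbove (range fun α : ℝ => α * v - q * H α) := by
  have h1 : ∀ α, 0 ≤ α → (α - 1) ^ 2 * H 1 ≤ H α + H 1 := by
    intro α h0
    rcases le_total 1 α with h | h
    · have := hH.scale α 1 h
      rw [mul_one] at this
      have := hH.one
      nlinarith
    · have := hH.one
      have := hH.nonneg α
      have h3 : (α - 1) ^ 2 ≤ 1 := by nlinarith
      nlinarith
  have h2 : ∀ α, (|α| - 1) ^ 2 * H 1 ≤ H α + H 1 := by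
    intro α
    have := h1 |α| (abs_nonneg _)
    rcases abs_choice α with h | h
    · rwa [h] at this ⊢
    · rw [h] at this ⊢
      rwa [hH.even] at this
  have hc : 0 < q * H 1 := mul_pos hq hH.one
  refine ⟨v ^ 2 / (q * H 1) + |v| + q * H 1, ?_⟩
  rintro _ ⟨α, rfl⟩
  simp only
  have h3 := mul_le_mul_of_nonneg_left (h2 α) hq.le
  have h4 : α * v ≤ |α| * |v| := by rw [← abs_mul]; exact le_abs_self _
  have h5 : (|α| - 1) * |v| ≤ v ^ 2 / (q * H 1) + (|α| - 1) ^ 2 * (q * H 1) := by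
    rw [← sq_abs v, ← sub_nonneg]
    have : |v| ^ 2 / (q * H 1) + (|α| - 1) ^ 2 * (q * H 1) - (|α| - 1) * |v|
      = (|v| ^ 2 + ((|α| - 1) * (q * H 1)) ^ 2 - |v| * ((|α| - 1) * (q * H 1))) / (q * H 1) := by
      have := hH.one.ne'
      field_simp
    rw [this]
    apply div_nonneg _ hc.le
    nlinarith [sq_nonneg (|v| - ((|α| - 1) * (q * H 1))), sq_nonneg (|v|), sq_nonneg ((|α| - 1) * (q * H 1))]
  nlinarith

lemma le_Lq {H : ℝ → ℝ} (hH : HP H) {q : ℝ} (hq : 0 < q) (v α : ℝ) :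
    α * v - q * H α ≤ Lq H q v := le_ciSup (Lq_bdd hH hq v) α

lemma Lq_nonneg {H : ℝ → ℝ} (hH : HP H) {q : ℝ} (hq : 0 < q) (v : ℝ) : 0 ≤ Lq H q v := by
  simpa [hH.zero] using le_Lq hH hq v 0

lemma Lq_zero {H : ℝ → ℝ} (hH : HP H) {q : ℝ} (hq : 0 < q) : Lq H q 0 = 0 := by
  apply le_antisymm _ (Lq_nonneg hH hq 0)
  apply ciSup_le
  intro α
  have := hH.nonneg α
  nlinarith

lemma Lq_two {H : ℝ → ℝ} (hH : HP H) {q : ℝ} (hq : 0 < q) (v : ℝ) :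
    Lq H q (2 * v) ≤ 4 * Lq H q v := by
  apply ciSup_le
  intro α
  have h1 := le_Lq hH hq v (α / 2)
  have h2 := hH.scale 2 (α / 2) (by norm_num)
  rw [show 2 * (α / 2) = α by ring] at h2
  nlinarith

lemma Lq_anti {H : ℝ → ℝ} (hH : HP H) {q r : ℝ} (hq : 0 < q) (hqr : q ≤ r) (v : ℝ) :
    Lq H r v ≤ Lq H q v := by
  apply ciSup_le
  intro α
  have h1 := le_Lq hH hq v α
  have h2 := hH.nonneg α
  nlinarith

lemma Lq_scale {H : ℝ → ℝ} (hH : HP H) {q r : ℝ} (hq : 0 < q) (hqr : q ≤ r) (v : ℝ) :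
    Lq H q v ≤ (r / q) * Lq H r v := by
  apply ciSup_le
  intro α
  have hr : 0 < r := by linarith
  have h1 := le_Lq hH hr v (α / (r / q))
  have hl : 1 ≤ r / q := by rwa [one_le_div hq]
  have h2 := hH.scale (r / q) (α / (r / q)) hl
  rw [mul_div_cancel₀ _ (by positivity)] at h2
  have h3 := mul_le_mul_of_nonneg_left h1 (by linarith : 0 ≤ r / q)
  have h4 := mul_le_mul_of_nonneg_left h2 hq.le
  have e : r / q * (α / (r / q) * v - r * H (α / (r / q)))
     = α * v - q * ((r / q) ^ 2 * H (α / (r / q))) := by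
    field_simp
  linarith

lemma Lq_convex {H : ℝ → ℝ} (hH : HP H) {q : ℝ} (hq : 0 < q) (v w s : ℝ) (h0 : 0 ≤ s)
    (h1 : s ≤ 1) :
    Lq H q ((1 - s) * v + s * w) ≤ (1 - s) * Lq H q v + s * Lq H q w := by
  apply ciSup_le
  intro α
  have h2 := mul_le_mul_of_nonneg_left (le_Lq hH hq v α) (by linarith : 0 ≤ 1 - s)
  have h3 := mul_le_mul_of_nonneg_left (le_Lq hH hq w α) h0
  nlinarith

lemma Lq_even {H : ℝ → ℝ} (hH : HP H) {q : ℝ} (hq : 0 < q) (v : ℝ) :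
    Lq H q (-v) ≤ Lq H q v := by
  apply ciSup_le
  intro α
  have h1 := le_Lq hH hq v (-α)
  rw [hH.even] at h1
  linarith

lemma Lq_shift {H : ℝ → ℝ} (hH : HP H) {q : ℝ} (hq : 0 < q) (v k : ℝ) (hk : |k| ≤ 1) :
    Lq H q (v + k) ≤ Lq H q v + |k| * (2 * Lq H q v + Lq H q 2) := by
  have key : ∀ e : ℝ, (e = 1 ∨ e = -1) →
      Lq H q (v + |k| * e) ≤ Lq H q v + |k| * (2 * Lq H q v + Lq H q 2) := by
    intro e he
    have h2 : Lq H q (2 * e) ≤ Lq H q 2 := by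
      rcases he with rfl | rfl
      · simp
      · have := Lq_even hH hq 2
        rwa [show (2 : ℝ) * -1 = -2 by ring]
    have h3 := Lq_convex hH hq (2 * v) (2 * e) (1 / 2) (by norm_num) (by norm_num)
    rw [show (1 - 1 / 2) * (2 * v) + 1 / 2 * (2 * e) = v + e by ring] at h3
    have h4 := Lq_two hH hq v
    have h5 := Lq_convex hH hq v (v + e) |k| (abs_nonneg k) hk
    rw [show (1 - |k|) * v + |k| * (v + e) = v + |k| * e by ring] at h5
    have h6 := Lq_nonneg hH hq v
    have h7 := Lq_nonneg hH hq 2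
    have h8 : Lq H q (v + e) ≤ 2 * Lq H q v + Lq H q 2 := by linarith
    have h9 := mul_le_mul_of_nonneg_left h8 (abs_nonneg k)
    have h10 := mul_nonneg (abs_nonneg k) h6
    linarith
  rcases abs_choice k with h | h
  · have := key 1 (Or.inl rfl)
    rw [mul_one] at this
    rwa [show v + |k| = v + k by rw [h]] at this
  · have := key (-1) (Or.inr rfl)
    rwa [show v + |k| * -1 = v + k by rw [h]; ring] at this

/-- derived hypotheses -/
structure Hyp (G p b d β₀ : ℝ → ℝ) (βbar α₀ CR : ℝ) : Prop where
  meas : Measurable (fun z : ℝ × ℝ => Lfun G p z.1 z.2)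
  nonneg : ∀ x v, 0 ≤ Lfun G p x v
  zero : ∀ x, Lfun G p x 0 = 0
  super : ∀ M, 0 ≤ M → ∃ C, 0 ≤ C ∧ ∀ x v, M * |v| ≤ Lfun G p x v + C
  pert : ∀ B, 0 ≤ B → ∃ C, 0 ≤ C ∧ ∀ x y v k, |x| ≤ B → |y| ≤ B → |k| ≤ 1 →
    Lfun G p y (v + k) ≤ Lfun G p x v + C * (|y - x| + |k|) * (1 + Lfun G p x v)
  Rcont : Continuous (Rfun b p d)
  CRpos : 0 ≤ CR
  Rbd : ∀ x, |Rfun b p d x| ≤ CR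
  Rlip : ∀ B, ∃ C, 0 ≤ C ∧ ∀ x y, |x| ≤ B → |y| ≤ B → |Rfun b p d x - Rfun b p d y| ≤ C * |x - y|
  βlip : ∀ B, ∃ C, 0 ≤ C ∧ ∀ x y, |x| ≤ B → |y| ≤ B → |β₀ x - β₀ y| ≤ C * |x - y|
  αpos : 0 < α₀
  βle : ∀ x, β₀ x ≤ βbar - α₀ * |x|

lemma lip_ball {f : ℝ → ℝ} (hf : LocallyLipschitz f) (B : ℝ) :
    ∃ C, 0 ≤ C ∧ ∀ x y, |x| ≤ B → |y| ≤ B → |f x - f y| ≤ C * |x - y| := by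
  obtain ⟨K, hK⟩ := LocallyLipschitzOn.exists_lipschitzOnWith_of_compact
    (isCompact_Icc (a := -B) (b := B)) (hf.locallyLipschitzOn)
  refine ⟨K, K.2, fun x y hx hy => ?_⟩
  have := hK.dist_le_mul x (abs_le.1 hx) y (abs_le.1 hy)
  simpa [Real.dist_eq] using this

lemma mk_Hyp (G p b d β₀ : ℝ → ℝ)
    (hGcont : Continuous G) (hGpos : ∀ y, 0 < G y) (hGeven : ∀ y, G (-y) = G y)
    (hGint : Integrable G)
    (hGexp : ∀ α : ℝ, Integrable (fun y => Real.exp (α * y) * G y))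
    (hpLip : LocallyLipschitz p)
    (pl pu : ℝ) (hpl : 0 < pl) (hp : ∀ x, pl ≤ p x ∧ p x ≤ pu)
    (hb : ∀ x, 0 ≤ b x) (hbBdd : ∃ Cb, ∀ x, b x ≤ Cb) (hbLip : LocallyLipschitz b)
    (hd : ∀ x, 0 ≤ d x) (hdBdd : ∃ Cd, ∀ x, d x ≤ Cd) (hdLip : LocallyLipschitz d)
    (hβLip : LocallyLipschitz β₀)
    (βbar α₀ : ℝ) (hα₀ : 0 < α₀) (hβ : ∀ x, β₀ x ≤ βbar - α₀ * |x|) :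
    ∃ CR, Hyp G p b d β₀ βbar α₀ CR := by
  have hH := Hfun_HP G hGcont hGpos hGeven hGint hGexp
  obtain ⟨Cb, hCb⟩ := hbBdd
  obtain ⟨Cd, hCd⟩ := hdBdd
  have hpp : ∀ x, 0 < p x := fun x => by linarith [(hp x).1]
  have hL : ∀ x v, Lfun G p x v = Lq (Hfun G) (p x) v := fun x v => rfl
  have hpc := hpLip.continuous
  have hbc := hbLip.continuous
  have hdc := hdLip.continuous
  have hCb0 : 0 ≤ Cb := (hb 0).trans (hCb 0)
  have hCd0 : 0 ≤ Cd := (hd 0).trans (hCd 0)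
  have hpu : 0 < pu := by linarith [(hp 0).1, (hp 0).2]
  refine ⟨Cb + pu + Cd, ?_, ?_, ?_, ?_, ?_, ?_, by linarith, ?_, ?_, ?_, hα₀, hβ⟩
  · apply LowerSemicontinuous.measurable
    refine lowerSemicontinuous_ciSup (f := fun (α : ℝ) (z : ℝ × ℝ) => α * z.2 - p z.1 * Hfun G α)
      (fun z => Lq_bdd hH (hpp z.1) z.2) (fun α => ?_)
    apply Continuous.lowerSemicontinuous
    fun_prop
  · intro x v
    exact Lq_nonneg hH (hpp x) v
  · intro x
    exact Lq_zero hH (hpp x)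
  · intro M hM
    refine ⟨pu * Hfun G M, mul_nonneg hpu.le (hH.nonneg M), fun x v => ?_⟩
    rw [hL]
    have h1 := le_Lq hH (hpp x) v M
    have h2 := le_Lq hH (hpp x) v (-M)
    rw [hH.even] at h2
    have h3 := mul_le_mul_of_nonneg_right (hp x).2 (hH.nonneg M)
    rcases abs_choice v with h | h <;> rw [h] <;> linarith
  · intro B hB
    obtain ⟨K, hK0, hK⟩ := lip_ball hpLip B
    set c := Lq (Hfun G) pl 2 with hc
    have hc0 : 0 ≤ c := Lq_nonneg hH hpl 2
    set Λ := K / pl with hΛ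
    have hΛ0 : 0 ≤ Λ := by positivity
    refine ⟨Λ + (1 + Λ * (2 * B)) * (2 + c), by positivity, fun x y v k hx hy hk => ?_⟩
    rw [hL, hL]
    have h1 := Lq_shift hH (hpp x) v k hk
    have h2 : Lq (Hfun G) (p x) 2 ≤ c := Lq_anti hH hpl (hp x).1 2
    have h3 : Lq (Hfun G) (p y) (v + k) ≤ (1 + Λ * |y - x|) * Lq (Hfun G) (p x) (v + k) := by
      have h0 := Lq_nonneg hH (hpp x) (v + k)
      rcases le_total (p x) (p y) with h | h
      · have := Lq_anti hH (hpp x) h (v + k)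
        have h6 : 0 ≤ Λ * |y - x| := by positivity
        nlinarith
      · refine (Lq_scale hH (hpp y) h (v + k)).trans ?_
        apply mul_le_mul_of_nonneg_right _ h0
        have h5 := hK x y hx hy
        rw [abs_of_nonneg (by linarith), abs_sub_comm] at h5
        rw [div_le_iff₀ (hpp y)]
        have h6 : K * |y - x| ≤ Λ * |y - x| * p y := by
          rw [hΛ, div_mul_eq_mul_div, div_mul_eq_mul_div, le_div_iff₀ hpl]
          exact mul_le_mul_of_nonneg_left (hp y).1 (by positivity)
        nlinarith
    have hl0 := Lq_nonneg hH (hpp x) v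
    set l := Lq (Hfun G) (p x) v
    set δ := |y - x| with hδ
    have hδ0 : 0 ≤ δ := abs_nonneg _
    have hδB : δ ≤ 2 * B := by
      rw [hδ]; exact (abs_sub y x).trans (by linarith)
    have hk0 := abs_nonneg k
    have h4 : Lq (Hfun G) (p x) (v + k) ≤ l + |k| * ((2 + c) * (1 + l)) := by
      refine h1.trans ?_
      have : 2 * l + Lq (Hfun G) (p x) 2 ≤ (2 + c) * (1 + l) := by nlinarith
      have := mul_le_mul_of_nonneg_left this hk0
      linarith
    calc _ ≤ (1 + Λ * δ) * (l + |k| * ((2 + c) * (1 + l))) :=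
          h3.trans (mul_le_mul_of_nonneg_left h4 (by positivity))
      _ = l + Λ * δ * l + (1 + Λ * δ) * (|k| * ((2 + c) * (1 + l))) := by ring
      _ ≤ l + Λ * (δ + |k|) * (1 + l) + (1 + Λ * (2 * B)) * ((δ + |k|) * ((2 + c) * (1 + l))) := by
          have : Λ * δ * l ≤ Λ * (δ + |k|) * (1 + l) := by gcongr <;> linarith
          have : (1 + Λ * δ) * (|k| * ((2 + c) * (1 + l))) ≤
            (1 + Λ * (2 * B)) * ((δ + |k|) * ((2 + c) * (1 + l))) := by gcongr; linarith
          linarith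
      _ = _ := by ring
  · unfold Rfun; fun_prop
  · intro x
    unfold Rfun
    rw [abs_le]
    constructor <;> linarith [hb x, hCb x, hd x, hCd x, (hp x).1, (hp x).2]
  · intro B
    obtain ⟨K1, hK10, hK1⟩ := lip_ball hpLip B
    obtain ⟨K2, hK20, hK2⟩ := lip_ball hbLip B
    obtain ⟨K3, hK30, hK3⟩ := lip_ball hdLip B
    refine ⟨K1 + K2 + K3, by positivity, fun x y hx hy => ?_⟩
    have h1 := abs_le.1 (hK1 x y hx hy)
    have h2 := abs_le.1 (hK2 x y hx hy)
    have h3 := abs_le.1 (hK3 x y hx hy)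
    unfold Rfun
    rw [abs_le]
    constructor <;> linarith
  · exact lip_ball hβLip

section paths
variable {G p b d β₀ : ℝ → ℝ} {βbar α₀ CR : ℝ}

lemma cont_of_ac {f f' : ℝ → ℝ} {t : ℝ} (ht : 0 ≤ t) (hf' : IntegrableOn f' (Icc 0 t))
    (hac : ∀ s ∈ Icc (0 : ℝ) t, f s = f 0 + ∫ u in (0 : ℝ)..s, f' u) :
    ContinuousOn f (Icc 0 t) := by
  have h := intervalIntegral.continuousOn_primitive_interval (a := 0) (b := t) (f := f')
    (μ := volume) (by rwa [uIcc_of_le ht])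
  rw [uIcc_of_le ht] at h
  exact (continuousOn_const.add h).congr hac

lemma R_int (hy : Hyp G p b d β₀ βbar α₀ CR) {f : ℝ → ℝ} {t : ℝ}
    (hf : ContinuousOn f (Icc 0 t)) : IntegrableOn (fun u => Rfun b p d (f u)) (Icc 0 t) :=
  (hy.Rcont.comp_continuousOn hf).integrableOn_compact isCompact_Icc

lemma ii_of {g : ℝ → ℝ} {t s r : ℝ} (hg : IntegrableOn g (Icc 0 t)) (hs : s ∈ Icc 0 t)
    (hr : r ∈ Icc 0 t) : IntervalIntegrable g volume s r := by
  rw [intervalIntegrable_iff]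
  apply hg.mono_set
  intro u hu
  have := uIoc_subset_uIcc hu
  exact uIcc_subset_Icc hs hr this

lemma F_cont (hy : Hyp G p b d β₀ βbar α₀ CR) {f f' : ℝ → ℝ} {a t x : ℝ} (ht : 0 ≤ t)
    (hA : Admissible G p b d β₀ a t x f f') :
    ContinuousOn (Ffun G p b d β₀ f f') (Icc 0 t) := by
  have hf := cont_of_ac ht hA.int_f' hA.ac
  have h1 := intervalIntegral.continuousOn_primitive_interval (a := 0) (b := t)
    (μ := volume) (by rw [uIcc_of_le ht]; exact R_int hy hf)
  have h2 := intervalIntegral.continuousOn_primitive_interval (a := 0) (b := t)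
    (μ := volume) (by rw [uIcc_of_le ht]; exact hA.int_L)
  rw [uIcc_of_le ht] at h1 h2
  exact (continuousOn_const.add h1).sub h2

/-- increments of `F` -/
lemma F_incr (hy : Hyp G p b d β₀ βbar α₀ CR) {f f' : ℝ → ℝ} {a t x : ℝ} (ht : 0 ≤ t)
    (hA : Admissible G p b d β₀ a t x f f') {s r : ℝ} (hs : s ∈ Icc 0 t) (hr : r ∈ Icc 0 t)
    (hsr : s ≤ r) :
    Ffun G p b d β₀ f f' r + ∫ u in s..r, Lfun G p (f u) (f' u) ≤
      Ffun G p b d β₀ f f' s + CR * (r - s) := by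
  have hf := cont_of_ac ht hA.int_f' hA.ac
  have h0 : (0 : ℝ) ∈ Icc 0 t := ⟨le_rfl, ht⟩
  have hR := R_int hy hf
  have e1 := intervalIntegral.integral_add_adjacent_intervals (ii_of hR h0 hs) (ii_of hR hs hr)
  have e2 := intervalIntegral.integral_add_adjacent_intervals (ii_of hA.int_L h0 hs)
    (ii_of hA.int_L hs hr)
  have h3 : ∫ u in s..r, Rfun b p d (f u) ≤ ∫ u in s..r, CR := by
    apply intervalIntegral.integral_mono_on hsr (ii_of hR hs hr)
      intervalIntegrable_const
    intro u _
    exact (abs_le.1 (hy.Rbd _)).2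
  rw [intervalIntegral.integral_const, smul_eq_mul] at h3
  unfold Ffun
  linarith

lemma F_zero (f f' : ℝ → ℝ) : Ffun G p b d β₀ f f' 0 = β₀ (f 0) := by
  simp [Ffun]

/-- a priori bounds -/
lemma cost_bound (hy : Hyp G p b d β₀ βbar α₀ CR) {f f' : ℝ → ℝ} {a t x : ℝ} (ht : 0 ≤ t)
    (hA : Admissible G p b d β₀ a t x f f') {s : ℝ} (hs : s ∈ Icc 0 t) :
    a + ∫ u in (0 : ℝ)..s, Lfun G p (f u) (f' u) ≤ βbar + CR * t := by
  have h0 : (0 : ℝ) ∈ Icc 0 t := ⟨le_rfl, ht⟩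
  have h1 := F_incr hy ht hA h0 hs hs.1
  rw [F_zero] at h1
  have h2 := hA.constraint s hs
  have h3 := hy.βle (f 0)
  have h4 := mul_nonneg hy.αpos.le (abs_nonneg (f 0))
  have h5 := mul_le_mul_of_nonneg_left hs.2 hy.CRpos
  linarith

lemma range_bound (hy : Hyp G p b d β₀ βbar α₀ CR) (a T : ℝ) (hT : 0 ≤ T) :
    ∃ B, 0 ≤ B ∧ ∀ t x f f', 0 ≤ t → t ≤ T → Admissible G p b d β₀ a t x f f' →
      ∀ s ∈ Icc 0 t, |f s| ≤ B := by
  obtain ⟨C, hC0, hC⟩ := hy.super 1 zero_le_one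
  refine ⟨|(βbar - a) / α₀| + |βbar + CR * T - a| + C * T, by positivity, ?_⟩
  intro t x f f' ht htT hA s hs
  have h0 : (0 : ℝ) ∈ Icc 0 t := ⟨le_rfl, ht⟩
  have h1 : |f 0| ≤ |(βbar - a) / α₀| := by
    refine le_trans ?_ (le_abs_self _)
    rw [le_div_iff₀ hy.αpos]
    have h2 := hA.constraint 0 h0
    rw [F_zero] at h2
    have h3 := hy.βle (f 0)
    linarith
  have h2 := cost_bound hy ht hA hs
  have h3 : |∫ u in (0 : ℝ)..s, f' u| ≤ ∫ u in (0 : ℝ)..s, (Lfun G p (f u) (f' u) + C) := by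
    refine (intervalIntegral.abs_integral_le_integral_abs hs.1).trans ?_
    apply intervalIntegral.integral_mono_on hs.1 (ii_of hA.int_f' h0 hs).abs
      ((ii_of hA.int_L h0 hs).add intervalIntegrable_const)
    intro u _
    simpa using hC (f u) (f' u)
  rw [intervalIntegral.integral_add (ii_of hA.int_L h0 hs) intervalIntegrable_const,
    intervalIntegral.integral_const, smul_eq_mul] at h3
  have h4 : |f s| ≤ |f 0| + |∫ u in (0 : ℝ)..s, f' u| := by
    rw [hA.ac s hs]; exact abs_add_le _ _
  have h5 : CR * t ≤ CR * T := mul_le_mul_of_nonneg_left htT hy.CRpos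
  have h6 : (s - 0) * C ≤ C * T := by nlinarith [hs.2]
  have h7 := le_abs_self (βbar + CR * T - a)
  linarith

lemma pert_path (hy : Hyp G p b d β₀ βbar α₀ CR) {f f' f2 f2' g : ℝ → ℝ} {a t x D E : ℝ}
    (ht : 0 ≤ t) (hA : Admissible G p b d β₀ a t x f f')
    (h1 : IntegrableOn f2' (Icc 0 t))
    (h2 : ∀ s ∈ Icc (0 : ℝ) t, f2 s = f2 0 + ∫ u in (0 : ℝ)..s, f2' u)
    (hg : IntegrableOn g (Icc 0 t)) (hg0 : ∀ u ∈ Icc 0 t, 0 ≤ g u)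
    (hle : ∀ u ∈ Icc 0 t, Rfun b p d (f u) - Rfun b p d (f2 u) + Lfun G p (f2 u) (f2' u) ≤
      Lfun G p (f u) (f' u) + g u)
    (hD : β₀ (f 0) - β₀ (f2 0) ≤ D) (hE : ∫ u in (0 : ℝ)..t, g u ≤ E) :
    IntegrableOn (fun u => Lfun G p (f2 u) (f2' u)) (Icc 0 t) ∧
    ∀ s ∈ Icc 0 t, Ffun G p b d β₀ f f' s - D - E ≤ Ffun G p b d β₀ f2 f2' s := by
  have hf := cont_of_ac ht hA.int_f' hA.ac
  have hf2 := cont_of_ac ht h1 h2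
  have hRf := R_int hy hf
  have hRf2 := R_int hy hf2
  have hL2 : IntegrableOn (fun u => Lfun G p (f2 u) (f2' u)) (Icc 0 t) := by
    have hdom : IntegrableOn (fun u => Lfun G p (f u) (f' u) + g u + Rfun b p d (f2 u)
      - Rfun b p d (f u)) (Icc 0 t) := ((hA.int_L.add hg).add hRf2).sub hRf
    refine Integrable.mono' hdom ?_ ?_
    · have hm : AEMeasurable (fun u => (f2 u, f2' u)) (volume.restrict (Icc 0 t)) :=
        (hf2.aemeasurable measurableSet_Icc).prodMk h1.aemeasurable
      exact (hy.meas.comp_aemeasurable hm).aestronglyMeasurable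
    · refine (ae_restrict_iff' measurableSet_Icc).2 (ae_of_all _ fun u hu => ?_)
      rw [Real.norm_eq_abs, abs_of_nonneg (hy.nonneg _ _)]
      linarith [hle u hu]
  refine ⟨hL2, fun s hs => ?_⟩
  have h0 : (0 : ℝ) ∈ Icc 0 t := ⟨le_rfl, ht⟩
  have htt : t ∈ Icc 0 t := ⟨ht, le_rfl⟩
  have i1 := ii_of hRf h0 hs
  have i2 := ii_of hRf2 h0 hs
  have i3 := ii_of hL2 h0 hs
  have i4 := ii_of hA.int_L h0 hs
  have i5 := ii_of hg h0 hs
  have h5 : ∫ u in (0 : ℝ)..s, (Rfun b p d (f u) - Rfun b p d (f2 u) + Lfun G p (f2 u) (f2' u)) ≤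
      ∫ u in (0 : ℝ)..s, (Lfun G p (f u) (f' u) + g u) := by
    apply intervalIntegral.integral_mono_on hs.1 ((i1.sub i2).add i3) (i4.add i5)
    intro u hu
    exact hle u ⟨hu.1, hu.2.trans hs.2⟩
  rw [intervalIntegral.integral_add (i1.sub i2) i3, intervalIntegral.integral_sub i1 i2,
    intervalIntegral.integral_add i4 i5] at h5
  have h6 := intervalIntegral.integral_add_adjacent_intervals i5 (ii_of hg hs htt)
  have h7 : 0 ≤ ∫ u in s..t, g u := intervalIntegral.integral_nonneg hs.2 fun u hu =>
    hg0 u ⟨hs.1.trans hu.1, hu.2⟩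
  unfold Ffun
  linarith

lemma F_congr {f f' f2 f2' : ℝ → ℝ} {s : ℝ} (hs : 0 ≤ s) (h1 : ∀ u ∈ Icc 0 s, f u = f2 u)
    (h2 : ∀ u ∈ Icc 0 s, f' u = f2' u) :
    Ffun G p b d β₀ f f' s = Ffun G p b d β₀ f2 f2' s := by
  unfold Ffun
  rw [h1 0 ⟨le_rfl, hs⟩]
  congr 1
  · congr 1
    apply intervalIntegral.integral_congr
    intro u hu
    rw [uIcc_of_le hs] at hu
    simp only [h1 u hu]
  · apply intervalIntegral.integral_congr
    intro u hu
    rw [uIcc_of_le hs] at hu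
    simp only [h1 u hu, h2 u hu]

lemma restrict_path {f f' : ℝ → ℝ} {a t x s : ℝ} 
    (hA : Admissible G p b d β₀ a t x f f') (hs : s ∈ Icc 0 t) :
    Admissible G p b d β₀ a s (f s) f f' := by
  have hsub : Icc 0 s ⊆ Icc 0 t := Icc_subset_Icc_right hs.2
  exact ⟨hA.int_f'.mono_set hsub, fun r hr => hA.ac r (hsub hr), hA.int_L.mono_set hsub, rfl,
    fun r hr => hA.constraint r (hsub hr)⟩

lemma extend_path (hy : Hyp G p b d β₀ βbar α₀ CR) {f f' : ℝ → ℝ} {a t t' x : ℝ}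
    (ht : 0 ≤ t) (htt' : t ≤ t') (hA : Admissible G p b d β₀ a t x f f')
    (hF : a + CR * (t' - t) ≤ Ffun G p b d β₀ f f' t) :
    ∃ f2 f2', Admissible G p b d β₀ a t' x f2 f2' ∧
      Ffun G p b d β₀ f f' t - CR * (t' - t) ≤ Ffun G p b d β₀ f2 f2' t' := by
  set f2 : ℝ → ℝ := fun s => if s ≤ t then f s else x with hf2
  set f2' : ℝ → ℝ := fun s => if s ≤ t then f' s else 0 with hf2'
  have ht' : 0 ≤ t' := ht.trans htt'
  have e1 : ∀ s, s ≤ t → f2 s = f s := fun s hs => by simp [hf2, hs]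
  have e1' : ∀ s, s ≤ t → f2' s = f' s := fun s hs => by simp [hf2', hs]
  have e2 : ∀ s, t ≤ s → f2 s = x := fun s hs => by
    rcases hs.eq_or_lt with h | h
    · subst h; rw [e1 _ le_rfl, hA.endpoint]
    · simp [hf2, not_le.2 h]
  have e2' : ∀ s, t < s → f2' s = 0 := fun s hs => by simp [hf2', not_le.2 hs]
  have hU : Icc 0 t' = Icc 0 t ∪ Ioc t t' := (Icc_union_Ioc_eq_Icc ht htt').symm
  have i1 : IntegrableOn f2' (Icc 0 t') := by
    rw [hU]
    refine IntegrableOn.union (hA.int_f'.congr_fun (fun s hs => (e1' s hs.2).symm)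
      measurableSet_Icc) ?_
    exact (integrableOn_zero).congr_fun (fun s hs => (e2' s hs.1).symm) measurableSet_Ioc
  have eL : ∀ s, t < s → Lfun G p (f2 s) (f2' s) = 0 := fun s hs => by rw [e2' s hs, hy.zero]
  have i2 : IntegrableOn (fun u => Lfun G p (f2 u) (f2' u)) (Icc 0 t') := by
    rw [hU]
    refine IntegrableOn.union (hA.int_L.congr_fun (fun s hs => ?_)
      measurableSet_Icc) ?_
    · simp only [e1 s hs.2, e1' s hs.2]
    · exact (integrableOn_zero).congr_fun (fun s hs => (eL s hs.1).symm) measurableSet_Ioc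
  have h0 : (0 : ℝ) ∈ Icc 0 t' := ⟨le_rfl, ht'⟩
  have h1 : t ∈ Icc 0 t' := ⟨ht, htt'⟩
  have hac1 : ∀ s ∈ Icc 0 t, f2 s = f2 0 + ∫ u in (0 : ℝ)..s, f2' u := by
    intro s hs
    rw [e1 s hs.2, e1 0 ht, hA.ac s hs]
    congr 1
    apply intervalIntegral.integral_congr
    intro u hu
    rw [uIcc_of_le hs.1] at hu
    exact (e1' u (hu.2.trans hs.2)).symm
  have hzero : ∀ (g : ℝ → ℝ) s, t ≤ s → (∀ u, t < u → g u = 0) → ∫ u in t..s, g u = 0 := by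
    intro g s hs hg
    rw [intervalIntegral.integral_congr_ae (g := fun _ => 0), intervalIntegral.integral_zero]
    refine ae_of_all _ fun u hu => ?_
    rw [uIoc_of_le hs] at hu
    exact hg u hu.1
  have hac : ∀ s ∈ Icc 0 t', f2 s = f2 0 + ∫ u in (0 : ℝ)..s, f2' u := by
    intro s hs
    rcases le_total s t with h | h
    · exact hac1 s ⟨hs.1, h⟩
    · rw [← intervalIntegral.integral_add_adjacent_intervals (ii_of i1 h0 h1) (ii_of i1 h1 hs),
        hzero f2' s h e2', add_zero, ← hac1 t ⟨ht, le_rfl⟩, e2 s h, e2 t le_rfl]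
  have hFe : ∀ s ∈ Icc 0 t, Ffun G p b d β₀ f2 f2' s = Ffun G p b d β₀ f f' s := fun s hs =>
    F_congr hs.1 (fun u hu => e1 u (hu.2.trans hs.2)) (fun u hu => e1' u (hu.2.trans hs.2))
  have hR := R_int hy (cont_of_ac ht' i1 hac)
  have hFl : ∀ s ∈ Icc t t', Ffun G p b d β₀ f f' t - CR * (t' - t) ≤
      Ffun G p b d β₀ f2 f2' s := by
    intro s hs
    have hs' : s ∈ Icc 0 t' := ⟨ht.trans hs.1, hs.2⟩
    rw [← hFe t ⟨ht, le_rfl⟩]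
    have a1 := intervalIntegral.integral_add_adjacent_intervals (ii_of hR h0 h1) (ii_of hR h1 hs')
    have a2 := intervalIntegral.integral_add_adjacent_intervals (ii_of i2 h0 h1) (ii_of i2 h1 hs')
    rw [hzero _ s hs.1 eL] at a2
    have a3 : ∫ u in t..s, (-CR) ≤ ∫ u in t..s, Rfun b p d (f2 u) := by
      apply intervalIntegral.integral_mono_on hs.1 intervalIntegrable_const (ii_of hR h1 hs')
      intro u _
      exact (abs_le.1 (hy.Rbd _)).1
    rw [intervalIntegral.integral_const, smul_eq_mul] at a3
    have a4 := mul_le_mul_of_nonneg_left (sub_le_sub_right hs.2 t) hy.CRpos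
    unfold Ffun
    linarith
  refine ⟨f2, f2', ⟨i1, hac, i2, e2 t' htt', ?_⟩, hFl t' ⟨htt', le_rfl⟩⟩
  intro s hs
  rcases le_total s t with h | h
  · rw [hFe s ⟨hs.1, h⟩]; exact hA.constraint s ⟨hs.1, h⟩
  · linarith [hFl s ⟨h, hs.2⟩]

end paths

section paths2
variable {G p b d β₀ : ℝ → ℝ} {βbar α₀ CR : ℝ}

lemma integral_ind {g : ℝ → ℝ} {t s0 s : ℝ} (hg : IntegrableOn g (Icc 0 t)) (h0 : s0 ∈ Icc 0 t)
    (hs : s ∈ Icc 0 t) (h : s0 ≤ s) :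
    ∫ u in (0 : ℝ)..s, (Ioi s0).indicator g u = ∫ u in s0..s, g u := by
  have hi : IntegrableOn ((Ioi s0).indicator g) (Icc 0 t) := hg.indicator measurableSet_Ioi
  have hz : (0 : ℝ) ∈ Icc 0 t := ⟨le_rfl, h0.1.trans h0.2⟩
  rw [← intervalIntegral.integral_add_adjacent_intervals (ii_of hi hz h0) (ii_of hi h0 hs)]
  have e1 : ∫ u in (0 : ℝ)..s0, (Ioi s0).indicator g u = 0 := by
    rw [intervalIntegral.integral_congr (g := fun _ => 0), intervalIntegral.integral_zero]
    intro u hu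
    rw [uIcc_of_le h0.1] at hu
    exact indicator_of_notMem (not_lt.2 hu.2) _
  rw [e1, zero_add]
  apply intervalIntegral.integral_congr_ae
  refine ae_of_all _ fun u hu => ?_
  rw [uIoc_of_le h] at hu
  exact indicator_of_mem hu.1 _

lemma integral_aff {l : ℝ → ℝ} {s t A B : ℝ} (j : IntervalIntegrable l volume s t) :
    ∫ u in s..t, (A + B * (1 + l u)) = (t - s) * A + B * ((t - s) + ∫ u in s..t, l u) := by
  have c : ∀ A : ℝ, IntervalIntegrable (fun _ : ℝ => A) volume s t := fun A =>
    intervalIntegrable_const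
  rw [intervalIntegral.integral_add (f := fun _ => A) (g := fun u => B * (1 + l u)) (c A)
    (((c 1).add j).const_mul B), intervalIntegral.integral_const_mul B (fun u => 1 + l u),
    intervalIntegral.integral_add (c 1) j]
  simp

lemma spatial (hy : Hyp G p b d β₀ βbar α₀ CR) (a T : ℝ) (hT : 0 ≤ T) :
    ∃ K, 0 ≤ K ∧ ∀ t x f f' x2, 0 ≤ t → t ≤ T → Admissible G p b d β₀ a t x f f' →
      a + K * |x2 - x| ≤ Ffun G p b d β₀ f f' t →
      ∃ f2 f2', Admissible G p b d β₀ a t x2 f2 f2' ∧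
        Ffun G p b d β₀ f f' t - K * |x2 - x| ≤ Ffun G p b d β₀ f2 f2' t := by
  obtain ⟨B0, hB00, hB0⟩ := range_bound hy a T hT
  obtain ⟨Cp, hCp0, hCp⟩ := hy.pert (B0 + 1) (by linarith)
  obtain ⟨Cr, hCr0, hCr⟩ := hy.Rlip (B0 + 1)
  obtain ⟨Cβ, hCβ0, hCβ⟩ := hy.βlip (B0 + 1)
  have hCR := hy.CRpos
  set M := |βbar + CR * T - a| with hM
  have hM0 : 0 ≤ M := abs_nonneg _
  obtain ⟨K', hK'⟩ : ∃ K', K' = Cβ + Cr * T + Cp * (T + M) + Cp * (1 + T) * (1 + CR) := ⟨_, rfl⟩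
  have hK'0 : 0 ≤ K' := by rw [hK']; positivity
  have hKA : Cr * T + Cp * (1 + T) * (1 + CR) ≤ K' := by
    have : 0 ≤ Cp * (T + M) := by positivity
    linarith
  have hKB : Cβ + (Cr * T + Cp * (T + M)) ≤ K' := by
    have : 0 ≤ Cp * (1 + T) * (1 + CR) := by positivity
    linarith
  obtain ⟨K, hK⟩ : ∃ K, K = 2 * K' + 2 * CR + M + 1 := ⟨_, rfl⟩
  refine ⟨K, by linarith, ?_⟩
  intro t x f f' x2 ht htT hA hF
  obtain ⟨h, hh⟩ : ∃ h, h = x2 - x := ⟨_, rfl⟩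
  rw [← hh] at hF ⊢
  by_cases hz : h = 0
  · refine ⟨f, f', ?_, by simp [hz]⟩
    rw [show x2 = x by linarith]; exact hA
  have hpos : 0 < |h| := abs_pos.2 hz
  obtain ⟨η, hη⟩ : ∃ η, η = Ffun G p b d β₀ f f' t - a := ⟨_, rfl⟩
  have h0 : (0 : ℝ) ∈ Icc 0 t := ⟨le_rfl, ht⟩
  have htt : t ∈ Icc 0 t := ⟨ht, le_rfl⟩
  have hcost := cost_bound hy ht hA htt
  have hCRT : CR * t ≤ CR * T := mul_le_mul_of_nonneg_left htT hCR
  have hcostM : ∫ u in (0 : ℝ)..t, Lfun G p (f u) (f' u) ≤ M := by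
    have := le_abs_self (βbar + CR * T - a)
    linarith
  have hηM : η ≤ M := by
    have h1 := F_incr hy ht hA h0 htt ht
    rw [F_zero] at h1
    have h3 := hy.βle (f 0)
    have h4 := mul_nonneg hy.αpos.le (abs_nonneg (f 0))
    have h5 : 0 ≤ ∫ u in (0 : ℝ)..t, Lfun G p (f u) (f' u) :=
      intervalIntegral.integral_nonneg ht fun u _ => hy.nonneg _ _
    have := le_abs_self (βbar + CR * T - a)
    linarith
  have hKh : K * |h| ≤ η := by linarith
  have e1 : 2 * (K' * |h|) + 2 * (CR * |h|) + M * |h| + |h| ≤ η := by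
    rw [hK] at hKh; linarith
  have p1 : 0 ≤ K' * |h| := by positivity
  have p2 : 0 ≤ CR * |h| := by positivity
  have p3 : 0 ≤ M * |h| := by positivity
  have hη0 : 0 < η := by linarith
  have hh1 : |h| ≤ 1 := by
    by_contra hc
    push Not at hc
    nlinarith
  have hKK : K' * |h| ≤ K * |h| := by
    rw [hK]; nlinarith
  have hfB := hB0 t x f f' ht htT hA
  by_cases hcase : ∃ s ∈ Icc 0 t, Ffun G p b d β₀ f f' s ≤ a + η / 2
  · -- the path comes close to the constraint: perturb after the last such time
    obtain ⟨s0, ⟨hs0, hFs0⟩, hmax⟩ : ∃ s0, IsGreatest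
        (Icc 0 t ∩ Ffun G p b d β₀ f f' ⁻¹' Iic (a + η / 2)) s0 := by
      apply IsCompact.exists_isGreatest
      · exact (isCompact_Icc).of_isClosed_subset
          ((F_cont hy ht hA).preimage_isClosed_of_isClosed isClosed_Icc isClosed_Iic)
          inter_subset_left
      · obtain ⟨s, hs, hs'⟩ := hcase
        exact ⟨s, hs, hs'⟩
    have hafter : ∀ s ∈ Icc 0 t, s0 < s → a + η / 2 ≤ Ffun G p b d β₀ f f' s := by
      intro s hs hlt
      by_contra hc
      push Not at hc
      exact absurd (hmax ⟨hs, hc.le⟩) (not_le.2 hlt)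
    have hFs0' : Ffun G p b d β₀ f f' s0 ≤ a + η / 2 := hFs0
    have hinc := F_incr hy ht hA hs0 htt hs0.2
    have hLnn : 0 ≤ ∫ u in s0..t, Lfun G p (f u) (f' u) :=
      intervalIntegral.integral_nonneg hs0.2 fun u _ => hy.nonneg _ _
    obtain ⟨τ, hτ⟩ : ∃ τ, τ = t - s0 := ⟨_, rfl⟩
    rw [← hτ] at hinc
    have hτ1 : η / 2 ≤ CR * τ := by linarith
    have hLτ : ∫ u in s0..t, Lfun G p (f u) (f' u) ≤ CR * τ := by linarith
    have hτh : |h| ≤ τ := by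
      by_contra hc
      push Not at hc
      have := mul_le_mul_of_nonneg_left hc.le hCR
      linarith
    have hτ0 : 0 < τ := by linarith
    have hτT : τ ≤ T := by linarith [hs0.1]
    obtain ⟨k, hk⟩ : ∃ k, k = h / τ := ⟨_, rfl⟩
    have hkτ : k * τ = h := by rw [hk]; field_simp
    have hkτ' : |k| * τ = |h| := by rw [← hkτ, abs_mul, abs_of_pos hτ0]
    have hk1 : |k| ≤ 1 := by
      rw [hk, abs_div, abs_of_pos hτ0, div_le_one hτ0]; exact hτh
    set f2 : ℝ → ℝ := fun u => f u + k * max (u - s0) 0 with hf2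
    set f2' : ℝ → ℝ := fun u => f' u + (Ioi s0).indicator (fun _ => k) u with hf2'
    set g0 : ℝ → ℝ := fun u => Cr * |h| + Cp * (|h| + |k|) * (1 + Lfun G p (f u) (f' u)) with hg0
    set g : ℝ → ℝ := (Ioi s0).indicator g0 with hg
    have ea : ∀ u, u ≤ s0 → f2 u = f u := fun u hu => by
      simp only [hf2]; rw [max_eq_right (by linarith)]; ring
    have ea' : ∀ u, u ≤ s0 → f2' u = f' u := fun u hu => by
      simp only [hf2']; rw [indicator_of_notMem (show u ∉ Ioi s0 from not_lt.2 hu)]; ring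
    have eb' : ∀ u, s0 < u → f2' u = f' u + k := fun u hu => by
      simp only [hf2']; rw [indicator_of_mem (show u ∈ Ioi s0 from hu)]
    have eb : ∀ u, s0 ≤ u → f2 u = f u + k * (u - s0) := fun u hu => by
      simp only [hf2]; rw [max_eq_left (by linarith)]
    have iconst : IntegrableOn (fun _ : ℝ => k) (Icc 0 t) :=
        continuousOn_const.integrableOn_compact isCompact_Icc
    have iind : IntegrableOn ((Ioi s0).indicator (fun _ : ℝ => k)) (Icc 0 t) :=
      iconst.indicator measurableSet_Ioi
    have i1 : IntegrableOn f2' (Icc 0 t) := hA.int_f'.add iind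
    have hac : ∀ s ∈ Icc 0 t, f2 s = f2 0 + ∫ u in (0 : ℝ)..s, f2' u := by
      intro s hs
      rw [ea 0 hs0.1]
      rcases le_total s s0 with hle | hle
      · rw [ea s hle, hA.ac s hs]
        congr 1
        apply intervalIntegral.integral_congr
        intro u hu
        rw [uIcc_of_le hs.1] at hu
        exact (ea' u (hu.2.trans hle)).symm
      · simp only [hf2']
        rw [intervalIntegral.integral_add (ii_of hA.int_f' h0 hs) (ii_of iind h0 hs),
          integral_ind iconst hs0 hs hle, intervalIntegral.integral_const, smul_eq_mul, eb s hle,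
          hA.ac s hs]
        ring
    have i0 : IntegrableOn g0 (Icc 0 t) := by
      have c1 : IntegrableOn (fun _ : ℝ => Cr * |h|) (Icc 0 t) :=
        continuousOn_const.integrableOn_compact isCompact_Icc
      have c2 : IntegrableOn (fun _ : ℝ => (1 : ℝ)) (Icc 0 t) :=
        continuousOn_const.integrableOn_compact isCompact_Icc
      exact c1.add ((c2.add hA.int_L).const_mul _)
    have ig : IntegrableOn g (Icc 0 t) := i0.indicator measurableSet_Ioi
    have g0nn : ∀ u, 0 ≤ g0 u := fun u => by
      have := hy.nonneg (f u) (f' u)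
      simp only [hg0]; positivity
    have gnn : ∀ u ∈ Icc 0 t, 0 ≤ g u := fun u _ => indicator_nonneg (fun u _ => g0nn u) u
    have hle : ∀ u ∈ Icc 0 t, Rfun b p d (f u) - Rfun b p d (f2 u) + Lfun G p (f2 u) (f2' u) ≤
        Lfun G p (f u) (f' u) + g u := by
      intro u hu
      rcases le_or_gt u s0 with hlt | hlt
      · rw [ea u hlt, ea' u hlt]
        linarith [gnn u hu]
      · rw [show g u = g0 u from indicator_of_mem (show u ∈ Ioi s0 from hlt) _, eb' u hlt]
        have d1 : |f2 u - f u| ≤ |h| := by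
          rw [eb u hlt.le, add_sub_cancel_left, abs_mul, ← hkτ',
            abs_of_nonneg (by linarith : 0 ≤ u - s0)]
          exact mul_le_mul_of_nonneg_left (by linarith [hu.2]) (abs_nonneg _)
        have d2 : |f u| ≤ B0 + 1 := by linarith [hfB u hu]
        have d3 : |f2 u| ≤ B0 + 1 := by
          have : |f2 u| ≤ |f u| + |f2 u - f u| := by
            have := abs_add_le (f u) (f2 u - f u)
            rwa [add_sub_cancel] at this
          linarith [hfB u hu]
        have d4 := hCp (f u) (f2 u) (f' u) k d2 d3 hk1
        have d5 := (abs_le.1 (hCr (f u) (f2 u) d2 d3)).2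
        rw [abs_sub_comm] at d5
        have d6 : Cr * |f2 u - f u| ≤ Cr * |h| := mul_le_mul_of_nonneg_left d1 hCr0
        have hLn := hy.nonneg (f u) (f' u)
        have d7 : Cp * (|f2 u - f u| + |k|) * (1 + Lfun G p (f u) (f' u)) ≤
            Cp * (|h| + |k|) * (1 + Lfun G p (f u) (f' u)) := by gcongr
        simp only [hg0]
        linarith
    have hE : ∫ u in (0 : ℝ)..t, g u ≤ K' * |h| := by
      rw [hg, integral_ind i0 hs0 htt hs0.2]
      have j := ii_of hA.int_L hs0 htt
      simp only [hg0]
      rw [integral_aff j, ← hτ]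
      have q1 : τ * (Cr * |h|) ≤ Cr * T * |h| := by
        have := mul_le_mul_of_nonneg_right hτT (by positivity : 0 ≤ Cr * |h|)
        linarith
      have q2 : |h| + |k| ≤ (1 + T) * |k| := by
        rw [← hkτ']
        have := mul_le_mul_of_nonneg_left hτT (abs_nonneg k)
        linarith
      have q3 : Cp * (|h| + |k|) * (τ + ∫ u in s0..t, Lfun G p (f u) (f' u)) ≤
          Cp * ((1 + T) * |k|) * (τ + CR * τ) := by gcongr
      have q4 : Cp * ((1 + T) * |k|) * (τ + CR * τ) = Cp * (1 + T) * (1 + CR) * |h| := by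
        rw [← hkτ']; ring
      have q5 := mul_le_mul_of_nonneg_right hKA hpos.le
      linarith
    obtain ⟨iL, hFF⟩ := pert_path hy (D := 0) ht hA i1 hac ig gnn hle
      (by rw [ea 0 hs0.1]; simp) hE
    refine ⟨f2, f2', ⟨i1, hac, iL, ?_, ?_⟩, ?_⟩
    · rw [eb t hs0.2, ← hτ, hkτ, hA.endpoint]; linarith
    · intro s hs
      rcases le_or_gt s s0 with hlt | hlt
      · rw [F_congr hs.1 (fun u hu => ea u (hu.2.trans hlt)) (fun u hu => ea' u (hu.2.trans hlt))]
        exact hA.constraint s hs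
      · linarith [hFF s hs, hafter s hs hlt]
    · linarith [hFF t htt]
  · -- away from the constraint: translate the whole path
    push Not at hcase
    set f2 : ℝ → ℝ := fun u => f u + h with hf2
    set g : ℝ → ℝ := fun u => Cr * |h| + Cp * |h| * (1 + Lfun G p (f u) (f' u)) with hg
    have hac : ∀ s ∈ Icc 0 t, f2 s = f2 0 + ∫ u in (0 : ℝ)..s, f' u := by
      intro s hs
      simp only [hf2]
      rw [hA.ac s hs]; ring
    have ig : IntegrableOn g (Icc 0 t) := by
      have c1 : IntegrableOn (fun _ : ℝ => Cr * |h|) (Icc 0 t) :=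
        continuousOn_const.integrableOn_compact isCompact_Icc
      have c2 : IntegrableOn (fun _ : ℝ => (1 : ℝ)) (Icc 0 t) :=
        continuousOn_const.integrableOn_compact isCompact_Icc
      exact c1.add ((c2.add hA.int_L).const_mul _)
    have gnn : ∀ u ∈ Icc 0 t, 0 ≤ g u := fun u _ => by
      have := hy.nonneg (f u) (f' u)
      simp only [hg]; positivity
    have d2 : ∀ u ∈ Icc 0 t, |f u| ≤ B0 + 1 := fun u hu => by linarith [hfB u hu]
    have d3 : ∀ u ∈ Icc 0 t, |f2 u| ≤ B0 + 1 := fun u hu => by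
      have := abs_add_le (f u) h
      simp only [hf2]
      linarith [hfB u hu]
    have d1 : ∀ u, f2 u - f u = h := fun u => by simp [hf2]
    have hle : ∀ u ∈ Icc 0 t, Rfun b p d (f u) - Rfun b p d (f2 u) + Lfun G p (f2 u) (f' u) ≤
        Lfun G p (f u) (f' u) + g u := by
      intro u hu
      have d4 := hCp (f u) (f2 u) (f' u) 0 (d2 u hu) (d3 u hu) (by simp)
      have d5 := (abs_le.1 (hCr (f u) (f2 u) (d2 u hu) (d3 u hu))).2
      rw [abs_sub_comm, d1] at d5
      rw [add_zero, d1, abs_zero, add_zero] at d4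
      simp only [hg]
      linarith
    have hD : β₀ (f 0) - β₀ (f2 0) ≤ Cβ * |h| := by
      have d5 := (abs_le.1 (hCβ (f 0) (f2 0) (d2 0 h0) (d3 0 h0))).2
      rwa [abs_sub_comm, d1] at d5
    have hE : ∫ u in (0 : ℝ)..t, g u ≤ (Cr * T + Cp * (T + M)) * |h| := by
      have j := ii_of hA.int_L h0 htt
      simp only [hg]
      rw [integral_aff j, sub_zero]
      have q1 : t * (Cr * |h|) ≤ T * (Cr * |h|) := by gcongr
      have q3 : Cp * |h| * (t + ∫ u in (0 : ℝ)..t, Lfun G p (f u) (f' u)) ≤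
          Cp * |h| * (T + M) := by gcongr
      linarith
    obtain ⟨iL, hFF⟩ := pert_path hy ht hA hA.int_f' hac ig gnn hle hD hE
    have q5 := mul_le_mul_of_nonneg_right hKB hpos.le
    refine ⟨f2, f', ⟨hA.int_f', hac, iL, ?_, ?_⟩, ?_⟩
    · simp only [hf2]; rw [hA.endpoint]; linarith
    · intro s hs
      linarith [hFF s hs, hcase s hs]
    · linarith [hFF t htt]

lemma combined (hy : Hyp G p b d β₀ βbar α₀ CR) (a T : ℝ) (hT : 0 ≤ T) :
    ∃ K, 0 ≤ K ∧ ∀ t1 t2 x1 x2 f f', 0 ≤ t1 → t1 ≤ T → 0 ≤ t2 → t2 ≤ T →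
      Admissible G p b d β₀ a t1 x1 f f' →
      a + K * dist (t1, x1) (t2, x2) ≤ Ffun G p b d β₀ f f' t1 →
      ∃ f2 f2', Admissible G p b d β₀ a t2 x2 f2 f2' ∧
        Ffun G p b d β₀ f f' t1 - K * dist (t1, x1) (t2, x2) ≤ Ffun G p b d β₀ f2 f2' t2 := by
  obtain ⟨K, hK0, hK⟩ := spatial hy a T hT
  obtain ⟨C, hC0, hC⟩ := hy.super K hK0
  have hCR := hy.CRpos
  refine ⟨K + CR + C, by linarith, ?_⟩
  intro t1 t2 x1 x2 f f' ht1 ht1T ht2 ht2T hA hF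
  obtain ⟨D, hD⟩ : ∃ D, D = dist (t1, x1) (t2, x2) := ⟨_, rfl⟩
  have hDt : |t1 - t2| ≤ D := by
    rw [hD, Prod.dist_eq]; exact le_max_left _ _
  have hDx : |x2 - x1| ≤ D := by
    rw [hD, Prod.dist_eq, abs_sub_comm]; exact le_max_right _ _
  rw [← hD] at hF ⊢
  have hD0 : 0 ≤ D := (abs_nonneg _).trans hDt
  have m1 := mul_le_mul_of_nonneg_left hDx hK0
  have m2 := mul_le_mul_of_nonneg_left hDt hCR
  have m3 := mul_le_mul_of_nonneg_left hDt hC0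
  have m4 : 0 ≤ C * D := by positivity
  have m5 : 0 ≤ K * D := by positivity
  rcases le_total t1 t2 with h | h
  · rw [abs_sub_comm, abs_of_nonneg (by linarith)] at m2
    have m6 : 0 ≤ K * |x2 - x1| := by positivity
    obtain ⟨f3, f3', hA3, hF3⟩ := extend_path hy ht1 h hA (by linarith)
    obtain ⟨f4, f4', hA4, hF4⟩ := hK t2 x1 f3 f3' x2 ht2 ht2T hA3 (by linarith)
    exact ⟨f4, f4', hA4, by linarith⟩
  · rw [abs_of_nonneg (by linarith)] at m2 m3
    have hs : t2 ∈ Icc 0 t1 := ⟨ht2, h⟩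
    have htt : t1 ∈ Icc 0 t1 := ⟨ht1, le_rfl⟩
    have h0 : (0 : ℝ) ∈ Icc 0 t1 := ⟨le_rfl, ht1⟩
    have hA3 := restrict_path hA hs
    have hinc := F_incr hy ht1 hA hs htt h
    have hx : K * |f t2 - x1| ≤ ∫ u in t2..t1, (Lfun G p (f u) (f' u) + C) := by
      have e := intervalIntegral.integral_add_adjacent_intervals (ii_of hA.int_f' h0 hs)
        (ii_of hA.int_f' hs htt)
      have e1 := hA.ac t2 hs
      have e2 := hA.ac t1 htt
      rw [hA.endpoint] at e2
      have e3 : |f t2 - x1| = |∫ u in t2..t1, f' u| := by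
        rw [abs_sub_comm]; congr 1; linarith
      rw [e3]
      calc K * |∫ u in t2..t1, f' u| ≤ K * ∫ u in t2..t1, |f' u| :=
            mul_le_mul_of_nonneg_left (intervalIntegral.abs_integral_le_integral_abs h) hK0
        _ = ∫ u in t2..t1, K * |f' u| := (intervalIntegral.integral_const_mul _ _).symm
        _ ≤ _ := by
          apply intervalIntegral.integral_mono_on h ((ii_of hA.int_f' hs htt).abs.const_mul _)
            ((ii_of hA.int_L hs htt).add intervalIntegrable_const)
          intro u _
          exact hC (f u) (f' u)
    rw [intervalIntegral.integral_add (ii_of hA.int_L hs htt) intervalIntegrable_const,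
      intervalIntegral.integral_const, smul_eq_mul] at hx
    have tri : |x2 - f t2| ≤ |x2 - x1| + |f t2 - x1| := by
      have := abs_sub_le x2 x1 (f t2)
      rwa [abs_sub_comm x1] at this
    have m7 := mul_le_mul_of_nonneg_left tri hK0
    obtain ⟨f4, f4', hA4, hF4⟩ := hK t2 (f t2) f f' x2 ht2 ht2T hA3 (by linarith)
    exact ⟨f4, f4', hA4, by linarith⟩

end paths2
/-- For every `a ∈ ℝ`: `Ω_a` is open in `[0,∞) × ℝ` (relative topology);
`u_a` is bounded above locally in `t` and globally in `x`, indeed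
`u_a(t,x) ≤ β̄ + t·R̄` for all `t ≥ 0, x` (since `L ≥ 0`); and `u_a` is locally Lipschitz
continuous on `Ω̃_a` (on `Ω̃_a` the value `u_a` is a real number, expressed via `toReal`). -/
theorem stmt14 (G p b d β₀ : ℝ → ℝ)
    (hGcont : Continuous G) (hGpos : ∀ y, 0 < G y) (hGeven : ∀ y, G (-y) = G y)
    (hGint : Integrable G) (hGprob : ∫ y : ℝ, G y = 1)
    (hGexp : ∀ α : ℝ, Integrable (fun y => Real.exp (α * y) * G y))
    (hpLip : LocallyLipschitz p)
    (pl pu : ℝ) (hpl : 0 < pl) (hp : ∀ x, pl ≤ p x ∧ p x ≤ pu)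
    (hb : ∀ x, 0 ≤ b x) (hbBdd : ∃ Cb, ∀ x, b x ≤ Cb) (hbLip : LocallyLipschitz b)
    (hd : ∀ x, 0 ≤ d x) (hdBdd : ∃ Cd, ∀ x, d x ≤ Cd) (hdLip : LocallyLipschitz d)
    (Rbar : ℝ) (hR : ∀ x, Rfun b p d x ≤ Rbar)
    (hβLip : LocallyLipschitz β₀)
    (βbar α₀ : ℝ) (hα₀ : 0 < α₀) (hβ : ∀ x, β₀ x ≤ βbar - α₀ * |x|)
    (a : ℝ) :
    (∃ U : Set (ℝ × ℝ), IsOpen U ∧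
      Om G p b d β₀ a = U ∩ {q : ℝ × ℝ | 0 ≤ q.1}) ∧
    (∀ t x : ℝ, 0 ≤ t → uval G p b d β₀ a t x ≤ ((βbar + t * Rbar : ℝ) : EReal)) ∧
    (∀ q ∈ OmTilde G p b d β₀ a, ∃ ε > (0 : ℝ), ∃ C : ℝ, 0 ≤ C ∧
      ∀ q₁ ∈ OmTilde G p b d β₀ a, ∀ q₂ ∈ OmTilde G p b d β₀ a,
        dist q₁ q < ε → dist q₂ q < ε →
        |(uval G p b d β₀ a q₁.1 q₁.2).toReal - (uval G p b d β₀ a q₂.1 q₂.2).toReal| ≤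
          C * dist q₁ q₂) := by
  obtain ⟨CR, hy⟩ := mk_Hyp G p b d β₀ hGcont hGpos hGeven hGint hGexp hpLip pl pu hpl hp hb
    hbBdd hbLip hd hdBdd hdLip hβLip βbar α₀ hα₀ hβ
  have hub : ∀ t x f f', 0 ≤ t → Admissible G p b d β₀ a t x f f' →
      Ffun G p b d β₀ f f' t ≤ βbar + t * Rbar := by
    intro t x f f' ht hA
    have hf := cont_of_ac ht hA.int_f' hA.ac
    have hRi := R_int hy hf
    have h0 : (0 : ℝ) ∈ Icc 0 t := ⟨le_rfl, ht⟩
    have htt : t ∈ Icc 0 t := ⟨ht, le_rfl⟩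
    have h3 : ∫ u in (0 : ℝ)..t, Rfun b p d (f u) ≤ ∫ u in (0 : ℝ)..t, Rbar :=
      intervalIntegral.integral_mono_on ht (ii_of hRi h0 htt) intervalIntegrable_const
        fun u _ => hR _
    rw [intervalIntegral.integral_const, smul_eq_mul] at h3
    have h5 : 0 ≤ ∫ u in (0 : ℝ)..t, Lfun G p (f u) (f' u) :=
      intervalIntegral.integral_nonneg ht fun u _ => hy.nonneg _ _
    have h6 := hβ (f 0)
    have h7 := mul_nonneg hα₀.le (abs_nonneg (f 0))
    unfold Ffun
    linarith
  have hsup : ∀ t x : ℝ, 0 ≤ t → uval G p b d β₀ a t x ≤ ((βbar + t * Rbar : ℝ) : EReal) := by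
    intro t x ht
    apply sSup_le
    rintro z ⟨f, f', hA, rfl⟩
    exact EReal.coe_le_coe_iff.2 (hub t x f f' ht hA)
  have hle : ∀ t x f f', Admissible G p b d β₀ a t x f f' →
      (Ffun G p b d β₀ f f' t : EReal) ≤ uval G p b d β₀ a t x := fun t x f f' hA =>
    le_sSup ⟨f, f', hA, rfl⟩
  refine ⟨?_, hsup, ?_⟩
  · have key : ∀ q ∈ Om G p b d β₀ a, ∃ r > 0, ∀ q' : ℝ × ℝ, 0 ≤ q'.1 → dist q' q < r →
        q' ∈ Om G p b d β₀ a := by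
      rintro ⟨t, x⟩ ⟨⟨ht, -⟩, hlt⟩
      obtain ⟨z, ⟨f, f', hA, rfl⟩, hz⟩ := lt_sSup_iff.1 hlt
      simp only at ht hA hz
      rw [EReal.coe_lt_coe_iff] at hz
      obtain ⟨K, hK0, hK⟩ := combined hy a (t + 1) (by linarith)
      obtain ⟨η, hη⟩ : ∃ η, η = Ffun G p b d β₀ f f' t - a := ⟨_, rfl⟩
      have hη0 : 0 < η := by linarith
      refine ⟨min 1 (η / (K + 1)), by positivity, ?_⟩
      rintro ⟨t', x'⟩ ht' hd'
      simp only at ht'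
      have h1 := lt_of_lt_of_le hd' (min_le_left _ _)
      have h2 := lt_of_lt_of_le hd' (min_le_right _ _)
      rw [lt_div_iff₀ (by linarith)] at h2
      rw [dist_comm] at h1 h2
      have h3 : |t - t'| ≤ dist (t, x) (t', x') := by
        rw [Prod.dist_eq]; exact le_max_left _ _
      have h4 := (abs_le.1 h3).1
      have h5 : 0 ≤ dist (t, x) (t', x') := dist_nonneg
      obtain ⟨f2, f2', hA2, hF2⟩ := hK t t' x x' f f' ht (by linarith) ht' (by linarith) hA
        (by linarith)
      refine ⟨⟨ht', f2, f2', hA2⟩, lt_of_lt_of_le ?_ (hle t' x' f2 f2' hA2)⟩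
      rw [EReal.coe_lt_coe_iff]
      nlinarith
    choose! r hr0 hr using key
    refine ⟨⋃ q ∈ Om G p b d β₀ a, Metric.ball q (r q),
      isOpen_biUnion fun q _ => Metric.isOpen_ball, ?_⟩
    ext q'
    constructor
    · intro hq'
      exact ⟨mem_biUnion hq' (Metric.mem_ball_self (hr0 q' hq')), hq'.1.1⟩
    · rintro ⟨hU, h0⟩
      obtain ⟨q, hq, hb'⟩ := mem_iUnion₂.1 hU
      exact hr q hq q' h0 hb'
  · rintro ⟨t, x⟩ ⟨ht, -⟩
    simp only at ht
    obtain ⟨K, hK0, hK⟩ := combined hy a (t + 1) (by linarith)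
    -- values are real numbers
    have hreal : ∀ q ∈ OmTilde G p b d β₀ a,
        (((uval G p b d β₀ a q.1 q.2).toReal : ℝ) : EReal) = uval G p b d β₀ a q.1 q.2 ∧
        a ≤ (uval G p b d β₀ a q.1 q.2).toReal := by
      rintro ⟨s, y⟩ ⟨hs, f, f', hA⟩
      simp only at hs hA ⊢
      have h1 := hle s y f f' hA
      have h2 := hsup s y hs
      have e := EReal.coe_toReal (x := uval G p b d β₀ a s y)
        (ne_top_of_le_ne_top (EReal.coe_ne_top _) h2) (ne_bot_of_le_ne_bot (EReal.coe_ne_bot _) h1)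
      refine ⟨e, ?_⟩
      rw [← e, EReal.coe_le_coe_iff] at h1
      exact (hA.constraint s ⟨hs, le_rfl⟩).trans h1
    have main : ∀ q₁ ∈ OmTilde G p b d β₀ a, ∀ q₂ ∈ OmTilde G p b d β₀ a,
        dist q₁ (t, x) < 1 → dist q₂ (t, x) < 1 →
        (uval G p b d β₀ a q₁.1 q₁.2).toReal ≤ (uval G p b d β₀ a q₂.1 q₂.2).toReal +
          K * dist q₁ q₂ := by
      rintro ⟨t1, x1⟩ h1 ⟨t2, x2⟩ h2 hd1 hd2
      obtain ⟨r1, -⟩ := hreal _ h1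
      obtain ⟨r2, ha2⟩ := hreal _ h2
      simp only at r1 r2 ha2 ⊢
      have ht1 : 0 ≤ t1 := h1.1
      have ht2 : 0 ≤ t2 := h2.1
      have b1 : |t1 - t| < 1 := lt_of_le_of_lt (by rw [Prod.dist_eq]; exact le_max_left _ _) hd1
      have b2 : |t2 - t| < 1 := lt_of_le_of_lt (by rw [Prod.dist_eq]; exact le_max_left _ _) hd2
      have b1' := (abs_lt.1 b1).2
      have b2' := (abs_lt.1 b2).2
      rw [← EReal.coe_le_coe_iff, r1]
      apply sSup_le
      rintro z ⟨f, f', hA, rfl⟩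
      rw [EReal.coe_le_coe_iff]
      by_cases hc : a + K * dist (t1, x1) (t2, x2) ≤ Ffun G p b d β₀ f f' t1
      · obtain ⟨f2, f2', hA2, hF2⟩ := hK t1 t2 x1 x2 f f' ht1 (by linarith) ht2 (by linarith) hA hc
        have h3 := hle t2 x2 f2 f2' hA2
        rw [← r2, EReal.coe_le_coe_iff] at h3
        linarith
      · push Not at hc
        linarith
    refine ⟨1, one_pos, K, hK0, ?_⟩
    intro q₁ h1 q₂ h2 hd1 hd2
    have m1 := main q₁ h1 q₂ h2 hd1 hd2
    have m2 := main q₂ h2 q₁ h1 hd2 hd1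
    rw [dist_comm q₂] at m2
    rw [abs_le]
    constructor <;> linarith
end

section
/- For every a ∈ ℝ: u_a(t,x) ≥ a for all (t,x) ∈ Ω̃_a, u_a(t,x) = a for all (t,x) ∈ Ω̃_a \ Ω_a, and u_a is continuous on Ω̃_a at every point of Ω̃_a \ Ω_a: if (t_n,x_n) ∈ Ω̃_a converges to (t̄,x̄) ∈ Ω̃_a \ Ω_a, then u_a(t_n,x_n) → a. -/
open MeasureTheory Real Filter Set

lemma cosh_scale (μ x : ℝ) (hμ : 1 ≤ μ) :
    μ ^ 2 * (Real.cosh x - 1) ≤ Real.cosh (μ * x) - 1 := by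
  have h1 := (Real.hasSum_cosh x).sub (hasSum_ite_eq (0 : ℕ) (1 : ℝ))
  have h2 := (Real.hasSum_cosh (μ * x)).sub (hasSum_ite_eq (0 : ℕ) (1 : ℝ))
  refine hasSum_le ?_ (h1.mul_left (μ ^ 2)) h2
  intro n
  rcases Nat.eq_zero_or_pos n with rfl | hn
  · simp
  · have hne : n ≠ 0 := by omega
    simp only [hne, if_false, sub_zero]
    rw [mul_pow, mul_div_assoc]
    have : μ ^ 2 ≤ μ ^ (2 * n) := pow_le_pow_right₀ hμ (by omega)
    have h0 : 0 ≤ x ^ (2 * n) / ((2 * n).factorial : ℝ) := by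
      rw [pow_mul]; positivity
    exact mul_le_mul_of_nonneg_right this h0

section Hsec
variable {G : ℝ → ℝ}

lemma H_int (hGint : Integrable G)
    (hGexp : ∀ α : ℝ, Integrable (fun y => Real.exp (α * y) * G y)) (α : ℝ) :
    Integrable (fun y => (Real.exp (α * y) - 1) * G y) := by
  have := (hGexp α).sub hGint
  refine this.congr (Eventually.of_forall fun y => ?_)
  simp only [Pi.sub_apply]; ring

lemma H_neg (hGeven : ∀ y, G (-y) = G y) (α : ℝ) : Hfun G (-α) = Hfun G α := by
  unfold Hfun
  rw [← integral_neg_eq_self]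
  refine integral_congr_ae (Eventually.of_forall fun y => ?_)
  simp [hGeven]

lemma H_cosh (hGeven : ∀ y, G (-y) = G y) (hGint : Integrable G)
    (hGexp : ∀ α : ℝ, Integrable (fun y => Real.exp (α * y) * G y)) (α : ℝ) :
    Integrable (fun y => (Real.cosh (α * y) - 1) * G y) ∧
    Hfun G α = ∫ y, (Real.cosh (α * y) - 1) * G y := by
  have h1 := H_int hGint hGexp α
  have h2 := H_int hGint hGexp (-α)
  have e : (fun y => (Real.cosh (α * y) - 1) * G y) =
    fun y => (1/2 : ℝ) * ((Real.exp (α * y) - 1) * G y + (Real.exp (-α * y) - 1) * G y) := by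
    funext y
    rw [Real.cosh_eq]; ring_nf
  rw [e]
  refine ⟨(h1.add h2).const_mul _, ?_⟩
  rw [integral_const_mul, integral_add h1 h2]
  have := H_neg hGeven α
  unfold Hfun at *
  rw [this]; ring

lemma H_nonneg (hGpos : ∀ y, 0 < G y) (hGeven : ∀ y, G (-y) = G y) (hGint : Integrable G)
    (hGexp : ∀ α : ℝ, Integrable (fun y => Real.exp (α * y) * G y)) (α : ℝ) :
    0 ≤ Hfun G α := by
  rw [(H_cosh hGeven hGint hGexp α).2]
  refine integral_nonneg fun y => ?_
  exact mul_nonneg (by linarith [Real.one_le_cosh (α * y)]) (hGpos y).le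

lemma H_scale (hGpos : ∀ y, 0 < G y) (hGeven : ∀ y, G (-y) = G y) (hGint : Integrable G)
    (hGexp : ∀ α : ℝ, Integrable (fun y => Real.exp (α * y) * G y)) (μ α : ℝ) (hμ : 1 ≤ μ) :
    μ ^ 2 * Hfun G α ≤ Hfun G (μ * α) := by
  obtain ⟨h1, e1⟩ := H_cosh hGeven hGint hGexp α
  obtain ⟨h2, e2⟩ := H_cosh hGeven hGint hGexp (μ * α)
  rw [e1, e2, ← integral_const_mul]
  refine integral_mono (h1.const_mul _) h2 fun y => ?_
  have := mul_le_mul_of_nonneg_right (cosh_scale μ (α * y) hμ) (hGpos y).le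
  simp only
  rw [← mul_assoc, mul_assoc μ]; exact this

lemma H_one_pos (hGcont : Continuous G) (hGpos : ∀ y, 0 < G y) (hGeven : ∀ y, G (-y) = G y)
    (hGint : Integrable G)
    (hGexp : ∀ α : ℝ, Integrable (fun y => Real.exp (α * y) * G y)) : 0 < Hfun G 1 := by
  obtain ⟨h1, e1⟩ := H_cosh hGeven hGint hGexp 1
  rw [e1]
  refine integral_pos_of_integrable_nonneg_nonzero (x := 1) ?_ h1 ?_ ?_
  · have := Real.continuous_cosh
    fun_prop
  · intro y
    exact mul_nonneg (by linarith [Real.one_le_cosh (1 * y)]) (hGpos y).le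
  · have : 1 < Real.cosh (1 * 1) := Real.one_lt_cosh.2 (by norm_num)
    exact (mul_pos (by linarith) (hGpos 1)).ne'

lemma H_lower (hGpos : ∀ y, 0 < G y) (hGeven : ∀ y, G (-y) = G y) (hGint : Integrable G)
    (hGexp : ∀ α : ℝ, Integrable (fun y => Real.exp (α * y) * G y)) (α : ℝ) (h : 1 ≤ |α|) :
    α ^ 2 * Hfun G 1 ≤ Hfun G α := by
  have := H_scale hGpos hGeven hGint hGexp |α| 1 h
  rw [sq_abs, mul_one] at this
  rcases abs_choice α with e | e
  · rwa [e] at this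
  · rwa [e, H_neg hGeven] at this

end Hsec

/-- The properties of the Lagrangian that are used. -/
structure LagP (L : ℝ → ℝ → ℝ) (A : ℝ) (h : ℝ → ℝ) : Prop where
  meas : Measurable (fun z : ℝ × ℝ => L z.1 z.2)
  nonneg : ∀ x v, 0 ≤ L x v
  scale : ∀ l x v, 1 ≤ l → L x (l * v) ≤ l ^ 2 * L x v
  upper : ∀ x v, L x v ≤ |v| + A * v ^ 2
  lower : ∀ x v α, α * v - h α ≤ L x v
  A_nonneg : 0 ≤ A

lemma lag_L (G p : ℝ → ℝ)
    (hGcont : Continuous G) (hGpos : ∀ y, 0 < G y) (hGeven : ∀ y, G (-y) = G y)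
    (hGint : Integrable G)
    (hGexp : ∀ α : ℝ, Integrable (fun y => Real.exp (α * y) * G y))
    (hpc : Continuous p)
    (pl pu : ℝ) (hpl : 0 < pl) (hp : ∀ x, pl ≤ p x ∧ p x ≤ pu) :
    LagP (Lfun G p) (1 / (4 * pl * Hfun G 1)) (fun α => pu * Hfun G α) := by
  have h1 := H_one_pos hGcont hGpos hGeven hGint hGexp
  have hnn := H_nonneg hGpos hGeven hGint hGexp
  have hub : ∀ x v α, α * v - p x * Hfun G α ≤ |v| + (1 / (4 * pl * Hfun G 1)) * v ^ 2 := by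
    intro x v α
    have hpx := (hp x).1
    have hav : α * v ≤ |α| * |v| := by rw [← abs_mul]; exact le_abs_self _
    rcases le_total |α| 1 with ha | ha
    · have := mul_nonneg (hpl.le.trans hpx) (hnn α)
      have h3 : |α| * |v| ≤ 1 * |v| := mul_le_mul_of_nonneg_right ha (abs_nonneg v)
      have : 0 ≤ (1 / (4 * pl * Hfun G 1)) * v ^ 2 := by positivity
      linarith
    · have hl := H_lower hGpos hGeven hGint hGexp α ha
      have h3 : pl * (α ^ 2 * Hfun G 1) ≤ p x * Hfun G α :=
        mul_le_mul hpx hl (by positivity) (hpl.le.trans hpx)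
      have h4 : α * v ≤ pl * (α ^ 2 * Hfun G 1) + (1 / (4 * pl * Hfun G 1)) * v ^ 2 := by
        have hk : 0 < pl * Hfun G 1 := by positivity
        have : pl * (α ^ 2 * Hfun G 1) + (1 / (4 * pl * Hfun G 1)) * v ^ 2 - α * v
          = (pl * Hfun G 1) * (α - v / (2 * (pl * Hfun G 1))) ^ 2 := by
          field_simp; ring
        have : 0 ≤ (pl * Hfun G 1) * (α - v / (2 * (pl * Hfun G 1))) ^ 2 := by positivity
        linarith
      have := abs_nonneg v
      linarith
  have hbdd : ∀ x v, BddAbove (range fun α => α * v - p x * Hfun G α) := by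
    intro x v
    refine ⟨|v| + (1 / (4 * pl * Hfun G 1)) * v ^ 2, ?_⟩
    rintro _ ⟨α, rfl⟩
    exact hub x v α
  have hle : ∀ x v α, α * v - p x * Hfun G α ≤ Lfun G p x v := fun x v α => le_ciSup (hbdd x v) α
  refine ⟨?_, ?_, ?_, ?_, ?_, ?_⟩
  · apply LowerSemicontinuous.measurable
    unfold Lfun
    refine lowerSemicontinuous_ciSup (fun z => hbdd z.1 z.2) fun α => ?_
    apply Continuous.lowerSemicontinuous
    fun_prop
  · intro x v
    have := hle x v 0
    simpa [Hfun] using this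
  · intro l x v hl
    refine ciSup_le fun α => ?_
    have hl0 : l ≠ 0 := by positivity
    have h2 := H_scale hGpos hGeven hGint hGexp l (α / l) hl
    rw [mul_div_cancel₀ _ hl0] at h2
    have h3 := mul_le_mul_of_nonneg_left (hle x v (α / l)) (sq_nonneg l)
    have h4 := mul_le_mul_of_nonneg_left h2 (hpl.le.trans (hp x).1)
    have : l ^ 2 * (α / l * v) = α * (l * v) := by field_simp
    nlinarith
  · intro x v
    exact ciSup_le fun α => hub x v α
  · intro x v α
    have := mul_le_mul_of_nonneg_right (hp x).2 (hnn α)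
    have := hle x v α
    linarith
  · positivity

/-- absolutely continuous path with finite action on `[s,t]`. -/
structure Pth (L : ℝ → ℝ → ℝ) (f f' : ℝ → ℝ) (s t : ℝ) : Prop where
  le : s ≤ t
  int' : IntervalIntegrable f' volume s t
  ac : ∀ u ∈ Icc s t, f u = f s + ∫ r in s..u, f' r
  intL : IntervalIntegrable (fun u => L (f u) (f' u)) volume s t

/-- gain along a path. -/
noncomputable def Jf (R : ℝ → ℝ) (L : ℝ → ℝ → ℝ) (f f' : ℝ → ℝ) (s t : ℝ) : ℝ :=
  (∫ u in s..t, R (f u)) - ∫ u in s..t, L (f u) (f' u)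

namespace Pth
variable {L : ℝ → ℝ → ℝ} {f f' h h' : ℝ → ℝ} {r s t : ℝ} {R : ℝ → ℝ}

lemma ii {k : ℝ → ℝ} {s t s1 t1 : ℝ} (H : IntervalIntegrable k volume s t)
    (h1 : s ≤ s1) (h2 : s1 ≤ t1) (h3 : t1 ≤ t) : IntervalIntegrable k volume s1 t1 := by
  refine H.mono_set ?_
  rw [uIcc_of_le h2, uIcc_of_le (h1.trans (h2.trans h3))]
  exact Icc_subset_Icc h1 h3

lemma cont (P : Pth L f f' s t) : ContinuousOn f (Icc s t) := by
  have h := intervalIntegral.continuousOn_primitive_interval' P.int' (left_mem_uIcc)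
  rw [uIcc_of_le P.le] at h
  exact (continuousOn_const.add h).congr P.ac

lemma intR (P : Pth L f f' s t) (hR : Continuous R) :
    IntervalIntegrable (fun u => R (f u)) volume s t := by
  apply ContinuousOn.intervalIntegrable
  rw [uIcc_of_le P.le]
  exact hR.comp_continuousOn P.cont

lemma sub {s1 t1 : ℝ} (P : Pth L f f' s t) (h1 : s ≤ s1) (h2 : s1 ≤ t1) (h3 : t1 ≤ t) :
    Pth L f f' s1 t1 := by
  refine ⟨h2, ii P.int' h1 h2 h3, ?_, ii P.intL h1 h2 h3⟩
  intro u hu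
  rw [P.ac u ⟨h1.trans hu.1, hu.2.trans h3⟩, P.ac s1 ⟨h1, h2.trans h3⟩,
    ← intervalIntegral.integral_add_adjacent_intervals (b := s1)]
  · ring
  · exact ii P.int' le_rfl h1 (h2.trans h3)
  · exact ii P.int' h1 hu.1 (hu.2.trans h3)

lemma J_add {u : ℝ} (P : Pth L f f' s t) (hR : Continuous R) (h1 : s ≤ u) (h2 : u ≤ t) :
    Jf R L f f' s t = Jf R L f f' s u + Jf R L f f' u t := by
  unfold Jf
  have a := P.sub le_rfl h1 h2
  have b := P.sub h1 h2 le_rfl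
  rw [← intervalIntegral.integral_add_adjacent_intervals (a.intR hR) (b.intR hR),
    ← intervalIntegral.integral_add_adjacent_intervals a.intL b.intL]
  ring

lemma congr (P : Pth L f f' s t) (e : EqOn f h (Icc s t)) (e' : EqOn f' h' (Ioc s t)) :
    Pth L h h' s t := by
  refine ⟨P.le, ?_, ?_, ?_⟩
  · refine P.int'.congr ?_
    rw [uIoc_of_le P.le]; exact e'
  · intro u hu
    rw [← e hu, ← e ⟨le_rfl, P.le⟩, P.ac u hu]
    congr 1
    refine intervalIntegral.integral_congr_ae (Eventually.of_forall fun x hx => ?_)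
    rw [uIoc_of_le hu.1] at hx
    exact e' ⟨hx.1, hx.2.trans hu.2⟩
  · refine P.intL.congr ?_
    rw [uIoc_of_le P.le]
    intro x hx
    simp only
    rw [e ⟨hx.1.le, hx.2⟩, e' hx]

lemma J_congr (hst : s ≤ t) (e : EqOn f h (Icc s t)) (e' : EqOn f' h' (Ioc s t)) :
    Jf R L f f' s t = Jf R L h h' s t := by
  unfold Jf
  congr 1
  · refine intervalIntegral.integral_congr_ae (Eventually.of_forall fun x hx => ?_)
    rw [uIoc_of_le hst] at hx
    simp only [e ⟨hx.1.le, hx.2⟩]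
  · refine intervalIntegral.integral_congr_ae (Eventually.of_forall fun x hx => ?_)
    rw [uIoc_of_le hst] at hx
    simp only [e ⟨hx.1.le, hx.2⟩, e' hx]

lemma join (P : Pth L f f' r s) (Q : Pth L f f' s t) : Pth L f f' r t := by
  refine ⟨P.le.trans Q.le, P.int'.trans Q.int', ?_, P.intL.trans Q.intL⟩
  intro u hu
  rcases le_total u s with h | h
  · exact P.ac u ⟨hu.1, h⟩
  · rw [Q.ac u ⟨h, hu.2⟩, P.ac s ⟨P.le, le_rfl⟩,
      ← intervalIntegral.integral_add_adjacent_intervals P.int' (ii Q.int' le_rfl h hu.2)]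
    ring

/-- concatenation -/
lemma concat (P : Pth L f f' r s) (Q : Pth L h h' s t) (e : f s = h s) :
    ∃ g g' : ℝ → ℝ, Pth L g g' r t ∧ EqOn f g (Icc r s) ∧ EqOn f' g' (Ioc r s) ∧
      EqOn h g (Icc s t) ∧ EqOn h' g' (Ioc s t) := by
  classical
  refine ⟨fun u => if u ≤ s then f u else h u, fun u => if u ≤ s then f' u else h' u, ?_⟩
  have e1 : EqOn f (fun u => if u ≤ s then f u else h u) (Icc r s) := by
    intro x hx; simp [hx.2]
  have e2 : EqOn f' (fun u => if u ≤ s then f' u else h' u) (Ioc r s) := by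
    intro x hx; simp [hx.2]
  have e3 : EqOn h (fun u => if u ≤ s then f u else h u) (Icc s t) := by
    intro x hx
    rcases hx.1.eq_or_lt with rfl | hlt
    · simp [e]
    · simp [not_le.2 hlt]
  have e4 : EqOn h' (fun u => if u ≤ s then f' u else h' u) (Ioc s t) := by
    intro x hx; simp [not_le.2 hx.1]
  exact ⟨(P.congr e1 e2).join (Q.congr e3 e4), e1, e2, e3, e4⟩

lemma intRle {M : ℝ} (P : Pth L f f' s t) (hRM : ∀ x, |R x| ≤ M) :
    |∫ u in s..t, R (f u)| ≤ M * (t - s) := by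
  have := intervalIntegral.norm_integral_le_of_norm_le_const (a := s) (b := t) (C := M)
    (f := fun u => R (f u)) (fun x _ => by simpa using hRM (f x))
  rwa [abs_of_nonneg (sub_nonneg.2 P.le), Real.norm_eq_abs] at this

lemma intL_nonneg {A : ℝ} {hh : ℝ → ℝ} (hL : LagP L A hh) (hst : s ≤ t) :
    0 ≤ ∫ u in s..t, L (f u) (f' u) :=
  intervalIntegral.integral_nonneg hst fun _ _ => hL.nonneg _ _

lemma J_le {A M : ℝ} {hh : ℝ → ℝ} (hL : LagP L A hh) (P : Pth L f f' s t)
    (hRM : ∀ x, |R x| ≤ M) : Jf R L f f' s t ≤ M * (t - s) := by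
  have h1 := P.intRle hRM
  have h2 := intL_nonneg (f := f) (f' := f') hL P.le
  unfold Jf
  linarith [le_abs_self (∫ u in s..t, R (f u))]

lemma aff {k : ℝ → ℝ} {l c s t : ℝ} (hl : 0 < l)
    (H : IntervalIntegrable k volume (l * s + c) (l * t + c)) :
    IntervalIntegrable (fun u => k (l * u + c)) volume s t := by
  have h1 := H.comp_add_right c
  have h2 := h1.comp_mul_left (c := l)
  have e : ∀ s, (l * s + c - c) / l = s := fun s => by field_simp; ring
  rwa [e, e] at h2

lemma intL_scale {A : ℝ} {hh : ℝ → ℝ} (hL : LagP L A hh) (P : Pth L f f' s t) {l : ℝ}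
    (hl : 1 ≤ l) : IntervalIntegrable (fun u => L (f u) (l * f' u)) volume s t := by
  refine (P.intL.const_mul (l ^ 2)).mono_fun ?_ ?_
  · have h1 : AEMeasurable f (volume.restrict (uIoc s t)) := by
      rw [uIoc_of_le P.le]
      exact (P.cont.mono Ioc_subset_Icc_self).aemeasurable measurableSet_Ioc
    have h2 : AEMeasurable f' (volume.restrict (uIoc s t)) := by
      rw [uIoc_of_le P.le]
      exact P.int'.1.aestronglyMeasurable.aemeasurable
    exact (hL.meas.comp_aemeasurable (h1.prodMk (h2.const_mul l))).aestronglyMeasurable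
  · refine Eventually.of_forall fun u => ?_
    simp only [Real.norm_eq_abs]
    rw [abs_of_nonneg (hL.nonneg _ _), abs_of_nonneg (mul_nonneg (sq_nonneg l) (hL.nonneg _ _))]
    exact hL.scale _ _ _ hl

lemma speed {A : ℝ} {hh : ℝ → ℝ} (hL : LagP L A hh) {l c : ℝ} (hl : 1 ≤ l) (hst : s ≤ t)
    (P : Pth L f f' (l * s + c) (l * t + c)) :
    Pth L (fun u => f (l * u + c)) (fun u => l * f' (l * u + c)) s t := by
  have hl0 : 0 < l := by linarith
  refine ⟨hst, (aff hl0 P.int').const_mul l, ?_, aff hl0 (P.intL_scale hL hl)⟩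
  intro u hu
  rw [P.ac (l * u + c) ⟨by nlinarith [hu.1], by nlinarith [hu.2]⟩,
    intervalIntegral.integral_const_mul, intervalIntegral.integral_comp_mul_add _ hl0.ne',
    smul_eq_mul, mul_inv_cancel_left₀ hl0.ne']

lemma speed_J {A M : ℝ} {hh : ℝ → ℝ} (hL : LagP L A hh) {l c : ℝ} (hl : 1 ≤ l) (hst : s ≤ t)
    (P : Pth L f f' (l * s + c) (l * t + c)) (hRM : ∀ x, |R x| ≤ M) :
    Jf R L f f' (l * s + c) (l * t + c) - (l - 1) * M * (l * (t - s))
      - (l - 1) * (∫ u in (l * s + c)..(l * t + c), L (f u) (f' u)) ≤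
    Jf R L (fun u => f (l * u + c)) (fun u => l * f' (l * u + c)) s t := by
  have hl0 : 0 < l := by linarith
  have h1 := P.intRle hRM
  have h2 : (∫ u in (l * s + c)..(l * t + c), L (f u) (l * f' u)) ≤
      l ^ 2 * ∫ u in (l * s + c)..(l * t + c), L (f u) (f' u) := by
    rw [← intervalIntegral.integral_const_mul]
    exact intervalIntegral.integral_mono_on P.le (P.intL_scale hL hl) (P.intL.const_mul _)
      fun u _ => hL.scale _ _ _ hl
  unfold Jf
  rw [intervalIntegral.integral_comp_mul_add (fun u => R (f u)) hl0.ne',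
    intervalIntegral.integral_comp_mul_add (fun u => L (f u) (l * f' u)) hl0.ne']
  simp only [smul_eq_mul]
  generalize (∫ u in (l * s + c)..(l * t + c), L (f u) (l * f' u)) = X at *
  generalize (∫ u in (l * s + c)..(l * t + c), L (f u) (f' u)) = Y at *
  generalize (∫ u in (l * s + c)..(l * t + c), R (f u)) = Z at *
  have h3 : l⁻¹ * X ≤ l * Y := by
    rw [inv_mul_le_iff₀ hl0]; nlinarith
  have h4 : Z - l⁻¹ * Z ≤ (l - 1) * M * (l * (t - s)) := by
    have e1 : Z - l⁻¹ * Z = (1 - l⁻¹) * Z := by ring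
    have i1 : l⁻¹ ≤ 1 := inv_le_one_of_one_le₀ hl
    have i2 : 1 - l⁻¹ ≤ l - 1 := by
      have : l * l⁻¹ = 1 := mul_inv_cancel₀ hl0.ne'
      nlinarith [sq_nonneg (l - 1), inv_pos.2 hl0]
    have hb : Z ≤ M * (l * (t - s)) := by
      have e2 : M * (l * t + c - (l * s + c)) = M * (l * (t - s)) := by ring
      rw [e2] at h1
      exact (le_abs_self _).trans h1
    have hnn : 0 ≤ M * (l * (t - s)) :=
      mul_nonneg ((abs_nonneg _).trans (hRM 0)) (mul_nonneg hl0.le (sub_nonneg.2 hst))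
    rw [e1]
    calc (1 - l⁻¹) * Z ≤ (1 - l⁻¹) * (M * (l * (t - s))) :=
          mul_le_mul_of_nonneg_left hb (by linarith)
      _ ≤ (l - 1) * (M * (l * (t - s))) := mul_le_mul_of_nonneg_right i2 hnn
      _ = _ := by ring
  linarith

lemma line_meas {A : ℝ} {hh : ℝ → ℝ} (hL : LagP L A hh) (x w s t : ℝ) (hst : s ≤ t) :
    Pth L (fun u => x + w * (u - s)) (fun _ => w) s t := by
  refine ⟨hst, intervalIntegrable_const, ?_, ?_⟩
  · intro u hu
    simp; ring
  · refine (intervalIntegrable_const (c := |w| + A * w ^ 2)).mono_fun ?_ ?_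
    · have : Measurable (fun u => L (x + w * (u - s)) w) :=
        hL.meas.comp (f := fun u : ℝ => (x + w * (u - s), w)) (by fun_prop)
      exact this.aestronglyMeasurable
    · refine Eventually.of_forall fun u => ?_
      simp only [Real.norm_eq_abs]
      have := hL.upper (x + w * (u - s)) w
      rw [abs_of_nonneg (hL.nonneg _ _)]
      exact this.trans (le_abs_self _)

lemma line_J {A M : ℝ} {hh : ℝ → ℝ} (hL : LagP L A hh) (x w s t : ℝ) (hst : s ≤ t)
    (hRM : ∀ x, |R x| ≤ M) :
    - (M + (|w| + A * w ^ 2)) * (t - s) ≤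
      Jf R L (fun u => x + w * (u - s)) (fun _ => w) s t := by
  have P := line_meas hL x w s t hst
  have h1 := P.intRle hRM
  have h2 : (∫ u in s..t, L (x + w * (u - s)) w) ≤ (|w| + A * w ^ 2) * (t - s) := by
    have := intervalIntegral.integral_mono_on hst P.intL
      (intervalIntegrable_const (c := |w| + A * w ^ 2)) fun u _ => hL.upper _ _
    rw [intervalIntegral.integral_const, smul_eq_mul] at this
    linarith
  unfold Jf
  linarith [neg_abs_le (∫ u in s..t, R (x + w * (u - s)))]

end Pth

set_option maxHeartbeats 1600000 in
lemma core_pos {L : ℝ → ℝ → ℝ} {R β : ℝ → ℝ} {A M B T a ε xb : ℝ} {hh : ℝ → ℝ}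
    (hL : LagP L A hh) (hR : Continuous R) (hRM : ∀ x, |R x| ≤ M) (hβ : ∀ x, β x ≤ B)
    (hT : 0 < T) (hε : 0 < ε) :
    ∃ δ > 0, ∀ t x : ℝ, ∀ f f' : ℝ → ℝ, |t - T| < δ → |x - xb| < δ → Pth L f f' 0 t → f t = x →
      (∀ s ∈ Icc 0 t, a ≤ β (f 0) + Jf R L f f' 0 s) → a + ε ≤ β (f 0) + Jf R L f f' 0 t →
      ∃ g g' : ℝ → ℝ, Pth L g g' 0 T ∧ g T = xb ∧
        (∀ s ∈ Icc 0 T, a ≤ β (g 0) + Jf R L g g' 0 s) ∧ a < β (g 0) + Jf R L g g' 0 T := by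
  have hM : 0 ≤ M := (abs_nonneg _).trans (hRM 0)
  have hA := hL.A_nonneg
  obtain ⟨η, hη, hηT, hηε⟩ : ∃ η > 0, η ≤ T / 2 ∧ M * η ≤ ε / 16 := by
    refine ⟨min (T / 2) (ε / (16 * (M + 1))), by positivity, min_le_left _ _, ?_⟩
    calc M * min (T / 2) (ε / (16 * (M + 1))) ≤ (M + 1) * (ε / (16 * (M + 1))) :=
          mul_le_mul (by linarith) (min_le_right _ _) (by positivity) (by positivity)
      _ = ε / 16 := by field_simp
  obtain ⟨C, hC, hCd⟩ : ∃ C ≥ 0, B - a + M * (T + 1) ≤ C := 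
    ⟨|B - a + M * (T + 1)|, abs_nonneg _, le_abs_self _⟩
  obtain ⟨ν, hν, hνe⟩ : ∃ ν > 0, ν * (M * η + C) ≤ ε / 8 := by
    refine ⟨ε / (8 * (M * η + C + 1)), by positivity, ?_⟩
    rw [div_mul_eq_mul_div, div_le_div_iff₀ (by positivity) (by positivity)]
    nlinarith
  obtain ⟨κ, hκd⟩ : ∃ κ, κ = η * (ν / (1 + ν)) := ⟨_, rfl⟩
  have hκ : 0 < κ := by rw [hκd]; positivity
  have hκη : κ ≤ η := by
    rw [hκd]
    refine mul_le_of_le_one_right hη.le ?_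
    rw [div_le_one (by positivity)]; linarith
  have hκl : (1 + ν) * κ = η * ν := by rw [hκd]; field_simp
  refine ⟨min (κ / 2) (min 1 (ε / (8 * (1 + A)))), by positivity, ?_⟩
  intro t x f f' ht hx P hft hcon hend
  have ht1 : |t - T| < κ / 2 := ht.trans_le (min_le_left _ _)
  have ht2 : |t - T| < 1 := ht.trans_le ((min_le_right _ _).trans (min_le_left _ _))
  have hx1 : |x - xb| < κ / 2 := hx.trans_le (min_le_left _ _)
  have hx2 : (1 + A) * |x - xb| ≤ ε / 8 := by
    have : |x - xb| ≤ ε / (8 * (1 + A)) :=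
      (hx.trans_le ((min_le_right _ _).trans (min_le_right _ _))).le
    calc (1 + A) * |x - xb| ≤ (1 + A) * (ε / (8 * (1 + A))) :=
          mul_le_mul_of_nonneg_left this (by positivity)
      _ = ε / 8 := by field_simp
  rw [abs_lt] at ht1 ht2
  obtain ⟨s, hs⟩ : ∃ s, s = t - η := ⟨_, rfl⟩
  obtain ⟨τ, hτ⟩ : ∃ τ, τ = t - κ := ⟨_, rfl⟩
  obtain ⟨l, hl⟩ : ∃ l, l = 1 + ν := ⟨_, rfl⟩
  obtain ⟨c, hc⟩ : ∃ c, c = s - l * s := ⟨_, rfl⟩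
  have es : l * s + c = s := by rw [hc]; ring
  have eτ : l * τ + c = t := by
    rw [hc, hτ, hs, hl]; linarith
  have hl1 : 1 ≤ l := by linarith
  have hs0 : 0 ≤ s := by linarith
  have hsτ : s ≤ τ := by linarith
  have hτT : κ / 2 < T - τ := by linarith
  have hτT2 : T - τ ≤ 2 * η := by linarith
  have hst : s ≤ t := by linarith
  obtain ⟨w, hw⟩ : ∃ w, w = (xb - x) / (T - τ) := ⟨_, rfl⟩
  have hTτ0 : 0 < T - τ := by linarith
  have hwT : |w| * (T - τ) = |x - xb| := by
    rw [hw, abs_div, abs_of_pos hTτ0, div_mul_cancel₀ _ hTτ0.ne', abs_sub_comm]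
  have hw1 : |w| ≤ 1 := by
    by_contra hcon
    push Not at hcon
    have := mul_lt_mul_of_pos_right hcon hTτ0
    linarith only [this, hwT, hx1, hτT]
  have P1 := P.sub le_rfl hs0 hst
  have P2 : Pth L f f' (l * s + c) (l * τ + c) := by
    rw [es, eτ]; exact P.sub hs0 hst le_rfl
  have S := P2.speed hL hl1 hsτ
  obtain ⟨g1, g1', Q1, a1, a2, a3, a4⟩ := P1.concat S (by simp only [es])
  have Ln := Pth.line_meas hL x w τ T (by linarith)
  obtain ⟨g, g', Q, b1, b2, b3, b4⟩ := Q1.concat Ln (by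
    rw [← a3 ⟨hsτ, le_rfl⟩]; simp [eτ, hft])
  have hg0 : g 0 = f 0 := by
    rw [a1 ⟨le_rfl, hs0⟩, b1 ⟨le_rfl, hs0.trans hsτ⟩]
  -- first section
  have J1 : ∀ u ∈ Icc 0 s, Jf R L g g' 0 u = Jf R L f f' 0 u := by
    intro u hu
    rw [Pth.J_congr hu.1 (fun y hy => a1 ⟨hy.1, hy.2.trans hu.2⟩)
      (fun y hy => a2 ⟨hy.1, hy.2.trans hu.2⟩)]
    exact (Pth.J_congr hu.1 (fun y hy => b1 ⟨hy.1, hy.2.trans (hu.2.trans hsτ)⟩)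
      (fun y hy => b2 ⟨hy.1, hy.2.trans (hu.2.trans hsτ)⟩)).symm
  have hILt : (∫ u in (0 : ℝ)..t, L (f u) (f' u)) ≤ C := by
    have h1 := hcon t ⟨P.le, le_rfl⟩
    unfold Jf at h1
    have h2 := (le_abs_self _).trans (P.intRle hRM)
    have h3 := hβ (f 0)
    have : M * (t - 0) ≤ M * (T + 1) := mul_le_mul_of_nonneg_left (by linarith) hM
    linarith
  -- second section
  have J2 : ∀ u ∈ Icc s τ, a + ε - ε / 16 - ε / 8 ≤ β (g 0) + Jf R L g g' 0 u := by
    intro u hu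
    have hu1 : s ≤ l * u + c := by
      have := mul_le_mul_of_nonneg_left hu.1 (by linarith : 0 ≤ l)
      linarith only [this, es]
    have hu2 : l * u + c ≤ t := by
      have := mul_le_mul_of_nonneg_left hu.2 (by linarith : 0 ≤ l)
      linarith only [this, eτ]
    have e1 := (Q.sub le_rfl (hs0.trans hu.1) (by linarith [hu.2])).J_add hR hs0 hu.1
    have e2 : Jf R L (fun u => f (l * u + c)) (fun u => l * f' (l * u + c)) s u
        = Jf R L g g' s u := by
      rw [Pth.J_congr hu.1 (fun y hy => a3 ⟨hy.1, hy.2.trans hu.2⟩)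
        (fun y hy => a4 ⟨hy.1, hy.2.trans hu.2⟩)]
      exact (Pth.J_congr hu.1 (fun y hy => b1 ⟨hs0.trans hy.1, hy.2.trans hu.2⟩)
        (fun y hy => b2 ⟨hs0.trans_lt hy.1, hy.2.trans hu.2⟩))
    have P3 : Pth L f f' (l * s + c) (l * u + c) := by
      rw [es]; exact P.sub hs0 hu1 hu2
    have e3 := P3.speed_J (R := R) hL hl1 hu.1 hRM
    rw [e2, es] at e3
    rw [e1, J1 s ⟨hs0, le_rfl⟩, hg0]
    have e4 := (P.sub le_rfl (hs0.trans hu1) hu2).J_add hR hs0 hu1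
    have e5 := P.J_add hR (hs0.trans hu1) hu2
    have e6 := (P.sub (hs0.trans hu1) hu2 le_rfl).J_le hL hRM
    have e7 : M * (t - (l * u + c)) ≤ M * η := mul_le_mul_of_nonneg_left (by linarith) hM
    have e8 : (∫ v in s..(l * u + c), L (f v) (f' v)) ≤ C := by
      refine le_trans ?_ hILt
      have p1 := P.sub le_rfl hs0 hst
      have p2 := P.sub hs0 hu1 hu2
      have p3 := P.sub (hs0.trans hu1) hu2 le_rfl
      rw [← intervalIntegral.integral_add_adjacent_intervals (p1.intL.trans p2.intL) p3.intL,
        ← intervalIntegral.integral_add_adjacent_intervals p1.intL p2.intL]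
      have := Pth.intL_nonneg (f := f) (f' := f') hL hs0
      have := Pth.intL_nonneg (f := f) (f' := f') hL hu2
      linarith
    have e9 : (l - 1) * M * (l * (u - s)) ≤ ν * (M * η) := by
      have q1 : l * (u - s) ≤ η := by
        have : l * (u - s) = l * u + c - s := by rw [hc]; ring
        linarith
      have q2 : l - 1 = ν := by linarith
      rw [q2, mul_assoc]
      exact mul_le_mul_of_nonneg_left (mul_le_mul_of_nonneg_left q1 hM) hν.le
    have e10 : (l - 1) * (∫ v in s..(l * u + c), L (f v) (f' v)) ≤ ν * C := by
      have q2 : l - 1 = ν := by linarith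
      rw [q2]
      exact mul_le_mul_of_nonneg_left e8 hν.le
    linarith
  -- third section
  have J3 : ∀ u ∈ Icc τ T, a + ε / 2 ≤ β (g 0) + Jf R L g g' 0 u := by
    intro u hu
    have e1 := (Q.sub le_rfl ((hs0.trans hsτ).trans hu.1) hu.2).J_add hR (hs0.trans hsτ) hu.1
    have e2 := J2 τ ⟨hsτ, le_rfl⟩
    have e3 := Pth.line_J (R := R) hL x w τ u hu.1 hRM
    rw [Pth.J_congr hu.1 (fun y hy => b3 ⟨hy.1, hy.2.trans hu.2⟩)
        (fun y hy => b4 ⟨hy.1, hy.2.trans hu.2⟩)] at e3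
    have e4 : (M + (|w| + A * w ^ 2)) * (u - τ) ≤ 2 * (M * η) + ε / 8 := by
      have q1 : w ^ 2 ≤ |w| := by
        rw [← sq_abs]; nlinarith [abs_nonneg w]
      have q0 := abs_nonneg w
      calc (M + (|w| + A * w ^ 2)) * (u - τ) ≤ (M + (|w| + A * |w|)) * (T - τ) := by
            refine mul_le_mul ?_ (by linarith [hu.2]) (by linarith [hu.1]) (by positivity)
            have := mul_le_mul_of_nonneg_left q1 hA
            linarith
        _ = M * (T - τ) + (1 + A) * (|w| * (T - τ)) := by ring
        _ ≤ M * (2 * η) + ε / 8 := by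
            rw [hwT]
            exact add_le_add (mul_le_mul_of_nonneg_left hτT2 hM) hx2
        _ = _ := by ring
    linarith
  refine ⟨g, g', Q, ?_, ?_, ?_⟩
  · rw [← b3 ⟨by linarith, le_rfl⟩]
    simp only
    rw [hw, div_mul_cancel₀ _ hTτ0.ne']; ring
  · intro u hu
    rcases le_total u s with h | h
    · rw [J1 u ⟨hu.1, h⟩, hg0]
      exact hcon u ⟨hu.1, h.trans hst⟩
    rcases le_total u τ with h' | h'
    · linarith [J2 u ⟨h, h'⟩]
    · linarith [J3 u ⟨h', hu.2⟩]
  · linarith [J3 T ⟨by linarith, le_rfl⟩]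

lemma core_zero {L : ℝ → ℝ → ℝ} {R β : ℝ → ℝ} {A M B a ε xb : ℝ} {hh : ℝ → ℝ}
    (hL : LagP L A hh) (hRM : ∀ x, |R x| ≤ M) (hβ : ∀ x, β x ≤ B)
    (hβc : Continuous β) (hε : 0 < ε) (hxb : β xb ≤ a) :
    ∃ δ > 0, ∀ t x : ℝ, ∀ f f' : ℝ → ℝ, |t| < δ → |x - xb| < δ → Pth L f f' 0 t → f t = x →
      a + ε ≤ β (f 0) + Jf R L f f' 0 t → False := by
  have hM : 0 ≤ M := (abs_nonneg _).trans (hRM 0)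
  obtain ⟨ρ, hρ, hρβ⟩ := Metric.continuousAt_iff.1 (hβc.continuousAt (x := xb)) (ε / 2)
    (by positivity)
  obtain ⟨C, hC, hCd⟩ : ∃ C ≥ 0, B - a + M ≤ C := 
    ⟨|B - a + M|, abs_nonneg _, le_abs_self _⟩
  obtain ⟨α, hα, hαC⟩ : ∃ α > 0, 4 * C < α * ρ := 
    ⟨(4 * C + 1) / ρ, by positivity, by rw [div_mul_cancel₀ _ hρ.ne']; linarith⟩
  obtain ⟨K, hK, hK1, hK2⟩ : ∃ K > 0, hh α ≤ K ∧ hh (-α) ≤ K := 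
    ⟨|hh α| + |hh (-α)| + 1, by positivity, by
      linarith [le_abs_self (hh α), abs_nonneg (hh (-α))], by
      linarith [le_abs_self (hh (-α)), abs_nonneg (hh α)]⟩
  refine ⟨min (min 1 (ρ / 2)) (min (α * ρ / (4 * K)) (ε / (4 * (M + 1)))), by positivity, ?_⟩
  intro t x f f' ht hx P hft hend
  have t0 := P.le
  rw [abs_of_nonneg t0] at ht
  have ht1 : t ≤ 1 := (ht.trans_le ((min_le_left _ _).trans (min_le_left _ _))).le
  have ht2 : t * K ≤ α * ρ / 4 := by
    have : t ≤ α * ρ / (4 * K) := (ht.trans_le ((min_le_right _ _).trans (min_le_left _ _))).le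
    calc t * K ≤ α * ρ / (4 * K) * K := mul_le_mul_of_nonneg_right this hK.le
      _ = _ := by field_simp
  have ht3 : M * t ≤ ε / 4 := by
    have : t ≤ ε / (4 * (M + 1)) := (ht.trans_le ((min_le_right _ _).trans (min_le_right _ _))).le
    calc M * t ≤ (M + 1) * (ε / (4 * (M + 1))) := mul_le_mul (by linarith) this t0 (by positivity)
      _ = _ := by field_simp
  have hx1 : |x - xb| < ρ / 2 := hx.trans_le ((min_le_left _ _).trans (min_le_right _ _))
  have hIL : (∫ u in (0 : ℝ)..t, L (f u) (f' u)) ≤ C := by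
    unfold Jf at hend
    have h2 := (le_abs_self _).trans (P.intRle hRM)
    have h3 := hβ (f 0)
    have : M * (t - 0) ≤ M * 1 := mul_le_mul_of_nonneg_left (by linarith) hM
    linarith
  have hac := P.ac t ⟨t0, le_rfl⟩
  have key : ∀ α', hh α' ≤ K → α' * (x - f 0) ≤ C + α * ρ / 4 := by
    intro α' h'
    have h1 : (∫ u in (0 : ℝ)..t, (α' * f' u - K)) ≤ ∫ u in (0 : ℝ)..t, L (f u) (f' u) := by
      refine intervalIntegral.integral_mono_on t0
        ((P.int'.const_mul α').sub intervalIntegrable_const) P.intL fun u _ => ?_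
      linarith [hL.lower (f u) (f' u) α']
    rw [intervalIntegral.integral_sub (P.int'.const_mul α') intervalIntegrable_const,
      intervalIntegral.integral_const_mul, intervalIntegral.integral_const, smul_eq_mul] at h1
    have : x - f 0 = ∫ u in (0 : ℝ)..t, f' u := by linarith
    rw [this]
    linarith
  have k1 := key α hK1
  have k2 := key (-α) hK2
  have hd : |x - f 0| < ρ / 2 := by
    rw [abs_lt]
    constructor <;> nlinarith
  have hd2 : dist (f 0) xb < ρ := by
    rw [Real.dist_eq]
    have : f 0 - xb = -(x - f 0) + (x - xb) := by ring
    rw [this]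
    refine (abs_add_le _ _).trans_lt ?_
    rw [abs_neg]; linarith
  have hb := hρβ hd2
  rw [Real.dist_eq, abs_lt] at hb
  have := P.J_le hL hRM
  rw [sub_zero] at this
  linarith

lemma adm_iff {G p b d β₀ : ℝ → ℝ} {a t x : ℝ} {f f' : ℝ → ℝ} (ht : 0 ≤ t) :
    Admissible G p b d β₀ a t x f f' ↔ Pth (Lfun G p) f f' 0 t ∧ f t = x ∧
      ∀ s ∈ Icc 0 t, a ≤ β₀ (f 0) + Jf (Rfun b p d) (Lfun G p) f f' 0 s := by
  have e : ∀ k : ℝ → ℝ, IntegrableOn k (Icc 0 t) ↔ IntervalIntegrable k volume 0 t := by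
    intro k
    rw [intervalIntegrable_iff_integrableOn_Icc_of_le ht]
  have e2 : ∀ s, Ffun G p b d β₀ f f' s = β₀ (f 0) + Jf (Rfun b p d) (Lfun G p) f f' 0 s := by
    intro s; unfold Ffun Jf; ring
  constructor
  · intro h
    exact ⟨⟨ht, (e _).1 h.int_f', h.ac, (e _).1 h.int_L⟩, h.endpoint,
      fun s hs => by rw [← e2]; exact h.constraint s hs⟩
  · rintro ⟨h, h1, h2⟩
    exact ⟨(e _).2 h.int', h.ac, (e _).2 h.intL, h1, fun s hs => by rw [e2]; exact h2 s hs⟩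

/-- For every `a ∈ ℝ`: `u_a ≥ a` on `Ω̃_a`, `u_a = a` on `Ω̃_a \ Ω_a`, and
`u_a` restricted to `Ω̃_a` is continuous at every point of `Ω̃_a \ Ω_a`: if
`(tₙ,xₙ) ∈ Ω̃_a → (t̄,x̄) ∈ Ω̃_a \ Ω_a` then `u_a(tₙ,xₙ) → a`. -/
theorem stmt15 (G p b d β₀ : ℝ → ℝ)
    (hGcont : Continuous G) (hGpos : ∀ y, 0 < G y) (hGeven : ∀ y, G (-y) = G y)
    (hGint : Integrable G) (hGprob : ∫ y : ℝ, G y = 1)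
    (hGexp : ∀ α : ℝ, Integrable (fun y => Real.exp (α * y) * G y))
    (hpLip : LocallyLipschitz p)
    (pl pu : ℝ) (hpl : 0 < pl) (hp : ∀ x, pl ≤ p x ∧ p x ≤ pu)
    (hb : ∀ x, 0 ≤ b x) (hbBdd : ∃ Cb, ∀ x, b x ≤ Cb) (hbLip : LocallyLipschitz b)
    (hd : ∀ x, 0 ≤ d x) (hdBdd : ∃ Cd, ∀ x, d x ≤ Cd) (hdLip : LocallyLipschitz d)
    (Rbar : ℝ) (hR : ∀ x, Rfun b p d x ≤ Rbar)
    (hβLip : LocallyLipschitz β₀)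
    (βbar α₀ : ℝ) (hα₀ : 0 < α₀) (hβ : ∀ x, β₀ x ≤ βbar - α₀ * |x|)
    (a : ℝ) :
    (∀ q ∈ OmTilde G p b d β₀ a, (a : EReal) ≤ uval G p b d β₀ a q.1 q.2) ∧
    (∀ q ∈ OmTilde G p b d β₀ a \ Om G p b d β₀ a,
      uval G p b d β₀ a q.1 q.2 = (a : EReal)) ∧
    (∀ qbar ∈ OmTilde G p b d β₀ a \ Om G p b d β₀ a, ∀ qn : ℕ → ℝ × ℝ,
      (∀ n, qn n ∈ OmTilde G p b d β₀ a) → Tendsto qn atTop (nhds qbar) →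
      Tendsto (fun n => uval G p b d β₀ a (qn n).1 (qn n).2) atTop
        (nhds ((a : EReal)))) := by
  have e2 : ∀ (f f' : ℝ → ℝ) s, Ffun G p b d β₀ f f' s =
      β₀ (f 0) + Jf (Rfun b p d) (Lfun G p) f f' 0 s := by
    intro f f' s; unfold Ffun Jf; ring
  have part1 : ∀ q ∈ OmTilde G p b d β₀ a, (a : EReal) ≤ uval G p b d β₀ a q.1 q.2 := by
    rintro q ⟨hq, f, f', hf⟩
    refine le_trans ?_ (le_sSup ⟨f, f', hf, rfl⟩)
    exact EReal.coe_le_coe_iff.2 (hf.constraint q.1 ⟨hq, le_rfl⟩)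
  have part2 : ∀ q ∈ OmTilde G p b d β₀ a \ Om G p b d β₀ a,
      uval G p b d β₀ a q.1 q.2 = (a : EReal) := by
    rintro q ⟨h1, h2⟩
    refine le_antisymm ?_ (part1 q h1)
    by_contra h
    exact h2 ⟨h1, not_le.1 h⟩
  refine ⟨part1, part2, ?_⟩
  intro qbar hqbar qn hqn hlim
  obtain ⟨Cb, hCb⟩ := hbBdd
  obtain ⟨Cd, hCd⟩ := hdBdd
  have hL := lag_L G p hGcont hGpos hGeven hGint hGexp hpLip.continuous pl pu hpl hp
  have hRc : Continuous (Rfun b p d) := by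
    unfold Rfun
    exact (hbLip.continuous.add hpLip.continuous).sub hdLip.continuous
  have hRM : ∀ x, |Rfun b p d x| ≤ |Rbar| + |Cd| := by
    intro x
    rw [abs_le]
    have h1 := hR x
    have h2 : -Cd ≤ Rfun b p d x := by
      unfold Rfun
      linarith [hb x, (hp x).1, hCd x]
    constructor
    · linarith [le_abs_self Cd, abs_nonneg Rbar]
    · linarith [le_abs_self Rbar, abs_nonneg Cd]
  have hβB : ∀ x, β₀ x ≤ βbar := fun x => by
    have := hβ x
    have : 0 ≤ α₀ * |x| := by positivity
    linarith
  have hub := part2 qbar hqbar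
  have hle : ∀ f f', Admissible G p b d β₀ a qbar.1 qbar.2 f f' →
      β₀ (f 0) + Jf (Rfun b p d) (Lfun G p) f f' 0 qbar.1 ≤ a := by
    intro f f' hf
    rw [← e2, ← EReal.coe_le_coe_iff, ← hub]
    exact le_sSup ⟨f, f', hf, rfl⟩
  rw [tendsto_order]
  refine ⟨fun m hm => Eventually.of_forall fun n => hm.trans_le (part1 _ (hqn n)), ?_⟩
  intro m hm
  obtain ⟨c, hac, hcm⟩ := EReal.lt_iff_exists_real_btwn.1 hm
  rw [EReal.coe_lt_coe_iff] at hac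
  suffices H : ∃ δ > 0, ∀ t x : ℝ, 0 ≤ t → |t - qbar.1| < δ → |x - qbar.2| < δ → ∀ f f',
      Admissible G p b d β₀ a t x f f' → Ffun G p b d β₀ f f' t ≤ c by
    obtain ⟨δ, hδ, H⟩ := H
    have h1 := (continuous_fst.tendsto qbar).comp hlim
    have h2 := (continuous_snd.tendsto qbar).comp hlim
    filter_upwards [Metric.tendsto_nhds.1 h1 δ hδ, Metric.tendsto_nhds.1 h2 δ hδ] with n hn1 hn2
    refine lt_of_le_of_lt ?_ hcm
    refine sSup_le ?_
    rintro _ ⟨f, f', hf, rfl⟩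
    exact EReal.coe_le_coe_iff.2 (H _ _ (hqn n).1 hn1 hn2 f f' hf)
  have hε : 0 < c - a := by linarith
  rcases hqbar.1.1.eq_or_lt with h0 | h0
  · have hxb : β₀ qbar.2 ≤ a := by
      obtain ⟨f, f', hf⟩ := hqbar.1.2
      have := hle f f' hf
      rw [← h0] at this
      have h3 := hf.endpoint
      rw [← h0] at h3
      simpa [Jf, h3] using this
    obtain ⟨δ, hδ, H⟩ := core_zero hL hRM hβB hβLip.continuous hε hxb
    refine ⟨δ, hδ, ?_⟩
    intro t x t0 ht hx f f' hf
    by_contra hcon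
    push Not at hcon
    rw [e2] at hcon
    obtain ⟨k1, k2, k3⟩ := (adm_iff t0).1 hf
    rw [← h0, sub_zero] at ht
    exact H t x f f' ht hx k1 k2 (by linarith)
  · obtain ⟨δ, hδ, H⟩ := core_pos (a := a) (xb := qbar.2) hL hRc hRM hβB h0 hε
    refine ⟨δ, hδ, ?_⟩
    intro t x t0 ht hx f f' hf
    by_contra hcon
    push Not at hcon
    rw [e2] at hcon
    obtain ⟨k1, k2, k3⟩ := (adm_iff t0).1 hf
    obtain ⟨g, g', m1, m2, m3, m4⟩ := H t x f f' ht hx k1 k2 k3 (by linarith)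
    have := hle g g' ((adm_iff h0.le).2 ⟨m1, m2, m3⟩)
    linarith
end

section
/- Dynamic programming principle: let a ∈ ℝ and (t,x) ∈ Ω_a with t > 0. Then there exists τ₀ ∈ (0,t) such that for every τ ∈ (0,τ₀): u_a(t,x) = sup over absolutely continuous f : [t−τ,t] → ℝ with f(t) = x of the quantity ∫_{t−τ}^{t} ( R(f(s)) − L(f(s), ḟ(s)) ) ds + u_a(t−τ, f(t−τ)), where u_a(t−τ, y) = −∞ whenever (t−τ, y) ∉ Ω̃_a. -/
open MeasureTheory Real Filter Set

theorem aux_cont {f f' : ℝ → ℝ} {s0 s1 : ℝ} (h01 : s0 ≤ s1) (hi : IntegrableOn f' (Icc s0 s1))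
    (hac : ∀ s ∈ Icc s0 s1, f s = f s0 + ∫ u in s0..s, f' u) : ContinuousOn f (Icc s0 s1) := by
  have h1 : ContinuousOn (fun s => ∫ u in s0..s, f' u) (uIcc s0 s1) :=
    intervalIntegral.continuousOn_primitive_interval (by rwa [uIcc_of_le h01])
  rw [uIcc_of_le h01] at h1
  exact (continuousOn_const.add h1).congr hac

theorem aux_ii {K : ℝ → ℝ} {r0 r1 s0 s1 : ℝ} (hi : IntegrableOn K (Icc r0 r1))
    (h0 : r0 ≤ s0) (h : s0 ≤ s1) (h1 : s1 ≤ r1) : IntervalIntegrable K volume s0 s1 := by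
  rw [intervalIntegrable_iff_integrableOn_Icc_of_le h]
  exact hi.mono_set (Icc_subset_Icc h0 h1)

theorem aux_glue {K K1 K2 : ℝ → ℝ} {T t : ℝ} (h0 : 0 ≤ T) (hT : T ≤ t)
    (i1 : IntegrableOn K1 (Icc 0 T)) (i2 : IntegrableOn K2 (Icc T t))
    (e1 : ∀ u ≤ T, K u = K1 u) (e2 : ∀ u, T < u → K u = K2 u) :
    IntegrableOn K (Icc 0 t) ∧ (∀ s ∈ Icc 0 T, ∫ u in (0:ℝ)..s, K u = ∫ u in (0:ℝ)..s, K1 u) ∧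
    (∀ s ∈ Icc T t, ∫ u in (0:ℝ)..s, K u = (∫ u in (0:ℝ)..T, K1 u) + ∫ u in T..s, K2 u) := by
  have hI : IntegrableOn K (Icc 0 t) := by
    rw [← Icc_union_Ioc_eq_Icc h0 hT]
    refine IntegrableOn.union ?_ ?_
    · exact i1.congr_fun (fun u hu => (e1 u hu.2).symm) measurableSet_Icc
    · exact (i2.mono_set Ioc_subset_Icc_self).congr_fun (fun u hu => (e2 u hu.1).symm)
        measurableSet_Ioc
  have hA : ∀ s ∈ Icc 0 T, ∫ u in (0:ℝ)..s, K u = ∫ u in (0:ℝ)..s, K1 u := by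
    intro s hs
    apply intervalIntegral.integral_congr
    intro u hu
    rw [uIcc_of_le hs.1] at hu
    exact e1 u (hu.2.trans hs.2)
  refine ⟨hI, hA, ?_⟩
  intro s hs
  rw [← intervalIntegral.integral_add_adjacent_intervals (aux_ii hI le_rfl h0 hT)
    (aux_ii hI h0 hs.1 hs.2), hA T ⟨h0, le_rfl⟩]
  congr 1
  apply intervalIntegral.integral_congr_ae
  refine Eventually.of_forall fun u hu => ?_
  rw [uIoc_of_le hs.1] at hu
  exact e2 u hu.1

theorem aux_Lnn (G p : ℝ → ℝ) (x v : ℝ) : 0 ≤ Lfun G p x v := by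
  unfold Lfun
  by_cases h : BddAbove (range fun α : ℝ => α * v - p x * Hfun G α)
  · refine le_trans ?_ (le_ciSup h 0)
    simp [Hfun]
  · rw [Real.iSup_of_not_bddAbove h]

/-- dynamic programming principle: let `a ∈ ℝ` and `(t,x) ∈ Ω_a`, `t > 0`.
Then there is `τ₀ ∈ (0,t)` such that for every `τ ∈ (0,τ₀)`,
`u_a(t,x) = sup { ∫_{t−τ}^t (R(f(s)) − L(f(s),ḟ(s))) ds + u_a(t−τ, f(t−τ)) }`, the
supremum running over absolutely continuous `f : [t−τ,t] → ℝ` (with finite rate function)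
ending at `f(t) = x`; here `u_a(t−τ,y) = −∞ = ⊥` whenever `(t−τ,y) ∉ Ω̃_a`, which is
automatic from the `sup ∅ = ⊥` convention in the definition of `uval`. -/
theorem stmt16 (G p b d β₀ : ℝ → ℝ)
    (hGcont : Continuous G) (hGpos : ∀ y, 0 < G y) (hGeven : ∀ y, G (-y) = G y)
    (hGint : Integrable G) (hGprob : ∫ y : ℝ, G y = 1)
    (hGexp : ∀ α : ℝ, Integrable (fun y => Real.exp (α * y) * G y))
    (hpLip : LocallyLipschitz p)
    (pl pu : ℝ) (hpl : 0 < pl) (hp : ∀ x, pl ≤ p x ∧ p x ≤ pu)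
    (hb : ∀ x, 0 ≤ b x) (hbBdd : ∃ Cb, ∀ x, b x ≤ Cb) (hbLip : LocallyLipschitz b)
    (hd : ∀ x, 0 ≤ d x) (hdBdd : ∃ Cd, ∀ x, d x ≤ Cd) (hdLip : LocallyLipschitz d)
    (Rbar : ℝ) (hR : ∀ x, Rfun b p d x ≤ Rbar)
    (hβLip : LocallyLipschitz β₀)
    (βbar α₀ : ℝ) (hα₀ : 0 < α₀) (hβ : ∀ x, β₀ x ≤ βbar - α₀ * |x|)
    (a t x : ℝ) (ht : 0 < t) (hmem : (t, x) ∈ Om G p b d β₀ a) :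
    ∃ τ₀ : ℝ, 0 < τ₀ ∧ τ₀ < t ∧ ∀ τ : ℝ, 0 < τ → τ < τ₀ →
      uval G p b d β₀ a t x =
        sSup {z : EReal | ∃ f f' : ℝ → ℝ,
          IntegrableOn f' (Icc (t - τ) t) ∧
          (∀ s ∈ Icc (t - τ) t, f s = f (t - τ) + ∫ u in (t - τ)..s, f' u) ∧
          IntegrableOn (fun u => Lfun G p (f u) (f' u)) (Icc (t - τ) t) ∧
          f t = x ∧
          z = (((∫ u in (t - τ)..t,
                  (Rfun b p d (f u) - Lfun G p (f u) (f' u))) : ℝ) : EReal) +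
              uval G p b d β₀ a (t - τ) (f (t - τ))} := by
  have hRc : Continuous (Rfun b p d) :=
    (hbLip.continuous.add hpLip.continuous).sub hdLip.continuous
  obtain ⟨c, hac, hcu⟩ := EReal.lt_iff_exists_real_btwn.1 hmem.2
  have hac : a < c := by exact_mod_cast hac
  simp only at hcu
  have hRp : 0 < |Rbar| + 1 := by positivity
  refine ⟨min (t / 2) ((c - a) / (|Rbar| + 1)), lt_min (by linarith)
    (div_pos (by linarith) hRp), (min_le_left _ _).trans_lt (by linarith), ?_⟩
  intro τ hτ hτ0
  have hτ1 : τ < t / 2 := hτ0.trans_le (min_le_left _ _)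
  have hτ2 : τ * (|Rbar| + 1) < c - a := by
    rw [← lt_div_iff₀ hRp]; exact hτ0.trans_le (min_le_right _ _)
  obtain ⟨T, hT⟩ : ∃ T, T = t - τ := ⟨_, rfl⟩
  rw [← hT]
  have hT0 : 0 ≤ T := by linarith
  have hTt : T ≤ t := by linarith
  apply le_antisymm
  · apply sSup_le
    rintro z ⟨f, f', hf, rfl⟩
    have hfi := hf.int_f'
    have hcont := aux_cont ht.le hfi hf.ac
    have hRi : IntegrableOn (fun u => Rfun b p d (f u)) (Icc 0 t) :=
      (hRc.comp_continuousOn hcont).integrableOn_Icc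
    have hadm : Admissible G p b d β₀ a T (f T) f f' :=
      { int_f' := hfi.mono_set (Icc_subset_Icc le_rfl hTt)
        ac := fun s hs => hf.ac s ⟨hs.1, hs.2.trans hTt⟩
        int_L := hf.int_L.mono_set (Icc_subset_Icc le_rfl hTt)
        endpoint := rfl
        constraint := fun s hs => hf.constraint s ⟨hs.1, hs.2.trans hTt⟩ }
    have hle : (Ffun G p b d β₀ f f' T : EReal) ≤ uval G p b d β₀ a T (f T) :=
      le_sSup ⟨f, f', hadm, rfl⟩
    have hF : Ffun G p b d β₀ f f' t = (∫ u in T..t, (Rfun b p d (f u) - Lfun G p (f u) (f' u)))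
        + Ffun G p b d β₀ f f' T := by
      rw [intervalIntegral.integral_sub (aux_ii hRi hT0 hTt le_rfl)
        (aux_ii hf.int_L hT0 hTt le_rfl)]
      unfold Ffun
      rw [← intervalIntegral.integral_add_adjacent_intervals (aux_ii hRi le_rfl hT0 hTt)
        (aux_ii hRi hT0 hTt le_rfl),
        ← intervalIntegral.integral_add_adjacent_intervals (aux_ii hf.int_L le_rfl hT0 hTt)
        (aux_ii hf.int_L hT0 hTt le_rfl)]
      ring
    refine le_trans ?_ (le_sSup ⟨f, f', hfi.mono_set (Icc_subset_Icc hT0 le_rfl), ?_,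
      hf.int_L.mono_set (Icc_subset_Icc hT0 le_rfl), hf.endpoint, rfl⟩)
    · rw [hF, EReal.coe_add]
      exact add_le_add le_rfl hle
    · intro s hs
      rw [hf.ac s ⟨hT0.trans hs.1, hs.2⟩, hf.ac T ⟨hT0, hTt⟩,
        ← intervalIntegral.integral_add_adjacent_intervals (aux_ii hfi le_rfl hT0 hTt)
        (aux_ii hfi hT0 hs.1 hs.2)]
      ring
  · apply sSup_le
    rintro z ⟨f, f', hfi, hfac, hfL, hfx, rfl⟩
    rw [add_comm, ← EReal.le_sub_iff_add_le (Or.inl (EReal.coe_ne_bot _))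
      (Or.inl (EReal.coe_ne_top _))]
    apply sSup_le
    rintro z ⟨g, g', hg, rfl⟩
    rw [EReal.le_sub_iff_add_le (Or.inl (EReal.coe_ne_bot _))
      (Or.inl (EReal.coe_ne_top _)), ← EReal.coe_add]
    have hfR : IntegrableOn (fun u => Rfun b p d (f u)) (Icc T t) :=
      (hRc.comp_continuousOn (aux_cont hTt hfi hfac)).integrableOn_Icc
    have hgR : IntegrableOn (fun u => Rfun b p d (g u)) (Icc 0 T) :=
      (hRc.comp_continuousOn (aux_cont hT0 hg.int_f' hg.ac)).integrableOn_Icc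
    obtain ⟨h, hh⟩ : ∃ h : ℝ → ℝ, h = fun u => if u ≤ T then g u else f u := ⟨_, rfl⟩
    obtain ⟨h', hh'⟩ : ∃ h' : ℝ → ℝ, h' = fun u => if u ≤ T then g' u else f' u := ⟨_, rfl⟩
    have e1 : ∀ u ≤ T, h u = g u := fun u hu => by simp [hh, hu]
    have e2 : ∀ u, T < u → h u = f u := fun u hu => by simp [hh, not_le.2 hu]
    have e1' : ∀ u ≤ T, h' u = g' u := fun u hu => by simp [hh', hu]
    have e2' : ∀ u, T < u → h' u = f' u := fun u hu => by simp [hh', not_le.2 hu]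
    have e3 : ∀ u, T ≤ u → h u = f u := by
      intro u hu
      rcases hu.eq_or_lt with rfl | hu
      · rw [e1 _ le_rfl, hg.endpoint]
      · exact e2 u hu
    obtain ⟨d1, d2, d3⟩ := aux_glue hT0 hTt hg.int_f' hfi e1' e2'
    obtain ⟨l1, l2, l3⟩ := aux_glue (K := fun u => Lfun G p (h u) (h' u)) hT0 hTt hg.int_L hfL
      (fun u hu => by simp only [e1 u hu, e1' u hu]) (fun u hu => by simp only [e2 u hu, e2' u hu])
    obtain ⟨r1, r2, r3⟩ := aux_glue (K := fun u => Rfun b p d (h u)) hT0 hTt hgR hfR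
      (fun u hu => by simp only [e1 u hu]) (fun u hu => by simp only [e2 u hu])
    have hFt : ∀ s ∈ Icc 0 T, Ffun G p b d β₀ h h' s = Ffun G p b d β₀ g g' s := by
      intro s hs
      unfold Ffun
      rw [l2 s hs, r2 s hs, e1 0 hT0]
    have hFs : ∀ s ∈ Icc T t, Ffun G p b d β₀ h h' s = Ffun G p b d β₀ g g' T +
        ((∫ u in T..s, Rfun b p d (f u)) - ∫ u in T..s, Lfun G p (f u) (f' u)) := by
      intro s hs
      unfold Ffun
      rw [l3 s hs, r3 s hs, e1 0 hT0]
      ring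
    have hFF : Ffun G p b d β₀ g g' T +
        (∫ u in T..t, (Rfun b p d (f u) - Lfun G p (f u) (f' u))) = Ffun G p b d β₀ h h' t := by
      rw [hFs t ⟨hTt, le_rfl⟩, intervalIntegral.integral_sub (aux_ii hfR le_rfl hTt le_rfl)
        (aux_ii hfL le_rfl hTt le_rfl)]
    rw [hFF]
    by_cases hc : Ffun G p b d β₀ h h' t ≤ c
    · exact le_trans (by exact_mod_cast hc) hcu.le
    push Not at hc
    refine le_sSup ⟨h, h', ⟨d1, ?_, l1, by rw [e3 t hTt, hfx], ?_⟩, rfl⟩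
    · intro s hs
      rcases le_total s T with hsT | hsT
      · rw [d2 s ⟨hs.1, hsT⟩, e1 s hsT, e1 0 hT0]
        exact hg.ac s ⟨hs.1, hsT⟩
      · rw [d3 s ⟨hsT, hs.2⟩, e3 s hsT, e1 0 hT0, hfac s ⟨hsT, hs.2⟩, ← hg.endpoint,
          hg.ac T ⟨hT0, le_rfl⟩]
        ring
    · intro s hs
      rcases le_total s T with hsT | hsT
      · rw [hFt s ⟨hs.1, hsT⟩]
        exact hg.constraint s ⟨hs.1, hsT⟩
      · have k1 := hFs s ⟨hsT, hs.2⟩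
        have k2 := hFs t ⟨hTt, le_rfl⟩
        rw [← intervalIntegral.integral_add_adjacent_intervals (aux_ii hfR le_rfl hsT hs.2)
          (aux_ii hfR hsT hs.2 le_rfl),
          ← intervalIntegral.integral_add_adjacent_intervals (aux_ii hfL le_rfl hsT hs.2)
          (aux_ii hfL hsT hs.2 le_rfl)] at k2
        have k3 : 0 ≤ ∫ u in s..t, Lfun G p (f u) (f' u) :=
          intervalIntegral.integral_nonneg hs.2 fun u _ => aux_Lnn G p _ _
        have k4 : ∫ u in s..t, Rfun b p d (f u) ≤ ∫ u in s..t, |Rbar| :=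
          intervalIntegral.integral_mono_on hs.2 (aux_ii hfR hsT hs.2 le_rfl)
            (by simp) fun u _ => (hR _).trans (le_abs_self _)
        rw [intervalIntegral.integral_const, smul_eq_mul] at k4
        have k5 : (t - s) * |Rbar| ≤ τ * |Rbar| :=
          mul_le_mul_of_nonneg_right (by linarith) (abs_nonneg _)
        linarith
end

section
/- For Lebesgue-almost every a₀ ∈ ℝ the following hold: (i) the set Ω̃_{a₀} \ Γ_{a₀} has zero two-dimensional Lebesgue measure in [0,∞)×ℝ; (ii) for every (t,x) ∈ Γ_{a₀} ∪ (([0,∞)×ℝ) \ Ω̃_{a₀}), one has lim_{a↓a₀} u_a(t,x) = u_{a₀}(t,x) (as a limit in [−∞,∞), with u_a(t,x) = −∞ whenever (t,x) ∉ Ω̃_a). -/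
open MeasureTheory Real Filter Set

/-- `Γ_{a₀} = ⋃_{a > a₀} Ω̃_a`. -/
def Gam (G p b d β₀ : ℝ → ℝ) (a₀ : ℝ) : Set (ℝ × ℝ) :=
  ⋃ a ∈ Ioi a₀, OmTilde G p b d β₀ a


lemma cosh_sub_one_ge (z : ℝ) : z ^ 2 / 2 ≤ Real.cosh z - 1 := by
  have h1 : Real.cosh z - 1 = 2 * Real.sinh (z / 2) ^ 2 := by
    have h := Real.cosh_two_mul (z / 2)
    have h2 := Real.cosh_sq (z / 2)
    rw [show 2 * (z / 2) = z by ring] at h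
    rw [h, h2]; ring
  have h2 : (z / 2) ^ 2 ≤ Real.sinh (z / 2) ^ 2 := by
    rcases le_total 0 (z / 2) with h | h
    · exact pow_le_pow_left₀ h (Real.self_le_sinh_iff.2 h) 2
    · have := Real.sinh_le_self_iff.2 h
      nlinarith
  rw [h1]; nlinarith

lemma Hfun_facts (G : ℝ → ℝ)
    (hGcont : Continuous G) (hGpos : ∀ y, 0 < G y) (hGeven : ∀ y, G (-y) = G y)
    (hGint : Integrable G) 
    (hGexp : ∀ α : ℝ, Integrable (fun y => Real.exp (α * y) * G y)) :
    Hfun G 0 = 0 ∧ (∃ c > 0, ∀ α, c * α ^ 2 ≤ Hfun G α) ∧ ∀ α, 4 * Hfun G α ≤ Hfun G (2 * α) := by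
  have key := Hfun_cosh G hGeven hGint hGexp
  refine ⟨by simp [Hfun], ?_, ?_⟩
  · have iy : Integrable (fun y => y ^ 2 / 2 * G y) := by
      refine (key 1).1.mono' (by fun_prop) (Eventually.of_forall fun y => ?_)
      have := hGpos y
      rw [Real.norm_of_nonneg (by positivity)]
      have := cosh_sub_one_ge y
      rw [one_mul]
      gcongr
    refine ⟨∫ y, y ^ 2 / 2 * G y, ?_, ?_⟩
    · refine integral_pos_of_integrable_nonneg_nonzero (x := 1) (by fun_prop) iy ?_ ?_
      · intro y; have := hGpos y; simp only [Pi.zero_apply]; positivity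
      · have := hGpos 1; simp; exact this.ne'
    · intro α
      rw [(key α).2, mul_comm, ← integral_const_mul]
      refine integral_mono (iy.const_mul _) (key α).1 fun y => ?_
      have h1 := cosh_sub_one_ge (α * y)
      have h2 := hGpos y
      calc α ^ 2 * (y ^ 2 / 2 * G y) = ((α * y) ^ 2 / 2) * G y := by ring
        _ ≤ _ := by gcongr
  · intro α
    rw [(key α).2, (key (2 * α)).2, ← integral_const_mul]
    refine integral_mono ((key α).1.const_mul _) (key _).1 fun y => ?_
    have h2 := hGpos y
    have h1 := Real.one_le_cosh (α * y)
    have h3 : 4 * (Real.cosh (α * y) - 1) ≤ Real.cosh (2 * α * y) - 1 := by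
      rw [mul_assoc, Real.cosh_two_mul, Real.sinh_sq]
      nlinarith
    calc 4 * ((Real.cosh (α * y) - 1) * G y) = (4 * (Real.cosh (α * y) - 1)) * G y := by ring
      _ ≤ _ := by gcongr

/-- Legendre transform with constant rate. -/
noncomputable def Lam (H : ℝ → ℝ) (c v : ℝ) : ℝ := ⨆ α : ℝ, (α * v - c * H α)

section Lam
variable {H : ℝ → ℝ} {c₀ : ℝ}

lemma Lam_term (hc₀ : 0 < c₀) (hH : ∀ α, c₀ * α ^ 2 ≤ H α) {c : ℝ} (hc : 0 < c) (v α : ℝ) :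
    α * v - c * H α ≤ v ^ 2 / (4 * (c * c₀)) := by
  have h1 : c * (c₀ * α ^ 2) ≤ c * H α := by gcongr; exact hH α
  have h2 : 0 < c * c₀ := by positivity
  rw [le_div_iff₀ (by positivity)]
  nlinarith [sq_nonneg (2 * (c * c₀) * α - v)]

lemma Lam_bdd (hc₀ : 0 < c₀) (hH : ∀ α, c₀ * α ^ 2 ≤ H α) {c : ℝ} (hc : 0 < c) (v : ℝ) :
    BddAbove (range fun α : ℝ => α * v - c * H α) :=
  ⟨_, by rintro _ ⟨α, rfl⟩; exact Lam_term hc₀ hH hc v α⟩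

lemma Lam_le_sq (hc₀ : 0 < c₀) (hH : ∀ α, c₀ * α ^ 2 ≤ H α) {c : ℝ} (hc : 0 < c) (v : ℝ) :
    Lam H c v ≤ v ^ 2 / (4 * (c * c₀)) := ciSup_le fun α => Lam_term hc₀ hH hc v α

lemma le_Lam (hc₀ : 0 < c₀) (hH : ∀ α, c₀ * α ^ 2 ≤ H α) {c : ℝ} (hc : 0 < c) (v α : ℝ) :
    α * v - c * H α ≤ Lam H c v := le_ciSup (Lam_bdd hc₀ hH hc v) α

lemma Lam_nonneg (hc₀ : 0 < c₀) (hH : ∀ α, c₀ * α ^ 2 ≤ H α) (h0 : H 0 = 0) {c : ℝ} (hc : 0 < c)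
    (v : ℝ) : 0 ≤ Lam H c v := by
  simpa [h0] using le_Lam hc₀ hH hc v 0

lemma Lam_anti (hc₀ : 0 < c₀) (hH : ∀ α, c₀ * α ^ 2 ≤ H α) {c c' : ℝ} (hc : 0 < c) (hcc : c ≤ c')
    (v : ℝ) : Lam H c' v ≤ Lam H c v := by
  refine ciSup_le fun α => le_trans ?_ (le_Lam hc₀ hH hc v α)
  have : 0 ≤ H α := le_trans (by positivity) (hH α)
  gcongr

lemma Lam_convex (hc₀ : 0 < c₀) (hH : ∀ α, c₀ * α ^ 2 ≤ H α) {c : ℝ} (hc : 0 < c) :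
    ConvexOn ℝ univ (Lam H c) := by
  refine ⟨convex_univ, fun x _ y _ a b ha hb hab => ciSup_le fun α => ?_⟩
  have h1 := le_Lam hc₀ hH hc x α
  have h2 := le_Lam hc₀ hH hc y α
  simp only [smul_eq_mul]
  have e : α * (a * x + b * y) - c * H α = a * (α * x - c * H α) + b * (α * y - c * H α) := by
    linear_combination (c * H α) * hab
  rw [e]; gcongr

lemma Lam_cont (hc₀ : 0 < c₀) (hH : ∀ α, c₀ * α ^ 2 ≤ H α) {c : ℝ} (hc : 0 < c) :
    Continuous (Lam H c) := by
  have := (Lam_convex hc₀ hH hc).continuousOn isOpen_univ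
  exact continuousOn_univ.1 this

lemma Lam_compare (hc₀ : 0 < c₀) (hH : ∀ α, c₀ * α ^ 2 ≤ H α)
    (h2 : ∀ α, 4 * H α ≤ H (2 * α)) {pl pu : ℝ} (hpl : 0 < pl) (hpu : 0 < pu) :
    ∃ K : ℝ, 0 < K ∧ ∀ v, Lam H pl v ≤ K * Lam H pu v := by
  obtain ⟨n, hn⟩ := pow_unbounded_of_one_lt (pu / pl) (one_lt_two : (1:ℝ) < 2)
  rw [div_lt_iff₀ hpl] at hn
  have hit : ∀ n : ℕ, ∀ α, 4 ^ n * H α ≤ H (2 ^ n * α) := by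
    intro n
    induction n with
    | zero => intro α; simp
    | succ k ih =>
      intro α
      calc 4 ^ (k + 1) * H α = 4 * (4 ^ k * H α) := by ring
        _ ≤ 4 * H (2 ^ k * α) := by gcongr; exact ih α
        _ ≤ H (2 * (2 ^ k * α)) := h2 _
        _ = _ := by congr 1; ring
  refine ⟨2 ^ n, by positivity, fun v => ciSup_le fun α => ?_⟩
  have h3 := le_Lam hc₀ hH hpu v (α / 2 ^ n)
  have hnn : (0:ℝ) < 2 ^ n := by positivity
  have h4 := hit n (α / 2 ^ n)
  rw [mul_div_cancel₀ _ hnn.ne'] at h4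
  have h5 : 0 ≤ H (α / 2 ^ n) := le_trans (by positivity) (hH _)
  calc α * v - pl * H α ≤ α * v - pl * (4 ^ n * H (α / 2 ^ n)) := by gcongr
    _ = α * v - 2 ^ n * ((2 ^ n * pl) * H (α / 2 ^ n)) := by
        rw [show (4:ℝ) = 2 * 2 by norm_num, mul_pow]; ring
    _ ≤ α * v - 2 ^ n * (pu * H (α / 2 ^ n)) := by gcongr
    _ = 2 ^ n * (α / 2 ^ n * v - pu * H (α / 2 ^ n)) := by field_simp
    _ ≤ _ := by gcongr
end Lam

structure Hyp_s17 (G p b d : ℝ → ℝ) (c₀ pl pu M : ℝ) : Prop where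
  hc₀ : 0 < c₀
  H0 : Hfun G 0 = 0
  hH : ∀ α, c₀ * α ^ 2 ≤ Hfun G α
  H2 : ∀ α, 4 * Hfun G α ≤ Hfun G (2 * α)
  hpl : 0 < pl
  hp : ∀ x, pl ≤ p x ∧ p x ≤ pu
  pc : Continuous p
  Rc : Continuous (Rfun b p d)
  hM : 0 ≤ M
  RM : ∀ x, -M ≤ Rfun b p d x

section main
variable {G p b d β₀ : ℝ → ℝ} {c₀ pl pu M : ℝ}

lemma Hyp_s17.ppos (h : Hyp_s17 G p b d c₀ pl pu M) (x : ℝ) : 0 < p x := h.hpl.trans_le (h.hp x).1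

lemma Hyp_s17.L_nonneg (h : Hyp_s17 G p b d c₀ pl pu M) (x v : ℝ) : 0 ≤ Lfun G p x v :=
  Lam_nonneg h.hc₀ h.hH h.H0 (h.ppos x) v

lemma Hyp_s17.L_le (h : Hyp_s17 G p b d c₀ pl pu M) (x v : ℝ) : Lfun G p x v ≤ Lam (Hfun G) pl v :=
  Lam_anti h.hc₀ h.hH h.hpl (h.hp x).1 v

lemma Hyp_s17.le_L (h : Hyp_s17 G p b d c₀ pl pu M) (x v α : ℝ) :
    α * v - pu * Hfun G α ≤ Lfun G p x v := by
  have h1 := le_Lam h.hc₀ h.hH (h.ppos x) v α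
  have h2 : 0 ≤ Hfun G α := le_trans (by have := h.hc₀; positivity) (h.hH α)
  have h3 : p x * Hfun G α ≤ pu * Hfun G α := by gcongr; exact (h.hp x).2
  change _ ≤ Lam (Hfun G) (p x) v
  linarith

lemma Hyp_s17.L_meas (h : Hyp_s17 G p b d c₀ pl pu M) (v : ℝ) : Measurable fun x => Lfun G p x v := by
  refine LowerSemicontinuous.measurable ?_
  refine lowerSemicontinuous_ciSup (fun x => Lam_bdd h.hc₀ h.hH (h.ppos x) v) fun α => ?_
  have := h.pc
  exact Continuous.lowerSemicontinuous (by fun_prop)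

lemma Admissible.contOn {a t x : ℝ} {f f' : ℝ → ℝ} (ht : 0 ≤ t)
    (hf : Admissible G p b d β₀ a t x f f') : ContinuousOn f (Icc 0 t) := by
  have h1 : ContinuousOn (fun s => f 0 + ∫ u in (0:ℝ)..s, f' u) (Icc 0 t) := by
    refine continuousOn_const.add ?_
    have := intervalIntegral.continuousOn_primitive_interval (a := 0) (b := t) (f := f') (μ := volume)
      (by rw [uIcc_of_le ht]; exact hf.int_f')
    rwa [uIcc_of_le ht] at this
  exact h1.congr hf.ac

lemma Admissible.restrict {a t x : ℝ} {f f' : ℝ → ℝ} 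
    (hf : Admissible G p b d β₀ a t x f f') {s : ℝ} (hs : s ∈ Icc 0 t) :
    Admissible G p b d β₀ a s (f s) f f' := by
  have hsub : Icc 0 s ⊆ Icc 0 t := Icc_subset_Icc_right hs.2
  exact ⟨hf.int_f'.mono_set hsub, fun u hu => hf.ac u (hsub hu), hf.int_L.mono_set hsub, rfl,
    fun u hu => hf.constraint u (hsub hu)⟩

lemma Admissible.mono {a a' t x : ℝ} {f f' : ℝ → ℝ} (haa : a' ≤ a)
    (hf : Admissible G p b d β₀ a t x f f') : Admissible G p b d β₀ a' t x f f' :=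
  ⟨hf.int_f', hf.ac, hf.int_L, hf.endpoint, fun s hs => haa.trans (hf.constraint s hs)⟩

lemma Hyp_s17.extend (h : Hyp_s17 G p b d c₀ pl pu M) {a a' t x t' x' e : ℝ} {f f' : ℝ → ℝ} (ht : 0 ≤ t)
    (hf : Admissible G p b d β₀ a t x f f') (haa : a' ≤ a) (htt : t < t')
    (he : (t' - t) * (M + Lam (Hfun G) pl ((x' - x) / (t' - t))) ≤ e)
    (hF : a' ≤ Ffun G p b d β₀ f f' t - e) :
    ∃ g g', Admissible G p b d β₀ a' t' x' g g' ∧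
      Ffun G p b d β₀ f f' t - e ≤ Ffun G p b d β₀ g g' t' := by
  set v := (x' - x) / (t' - t) with hv
  set K := Lam (Hfun G) pl v with hK
  have hK0 : 0 ≤ K := Lam_nonneg h.hc₀ h.hH h.H0 h.hpl v
  have hMK : 0 ≤ M + K := add_nonneg h.hM hK0
  have htt0 : 0 < t' - t := by linarith
  let g : ℝ → ℝ := fun s => if s ≤ t then f s else x + (s - t) * v
  let g' : ℝ → ℝ := fun s => if s ≤ t then f' s else v
  have gl : ∀ s, s ≤ t → g s = f s := fun s hs => if_pos hs
  have gl' : ∀ s, s ≤ t → g' s = f' s := fun s hs => if_pos hs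
  have gr : ∀ s, t < s → g s = x + (s - t) * v := fun s hs => if_neg (not_le.2 hs)
  have gr' : ∀ s, t < s → g' s = v := fun s hs => if_neg (not_le.2 hs)
  have hun : Icc 0 t' = Icc 0 t ∪ Ioc t t' := (Icc_union_Ioc_eq_Icc ht htt.le).symm
  have i1 : IntegrableOn g' (Icc 0 t') := by
    rw [hun]
    refine IntegrableOn.union ?_ ?_
    · exact hf.int_f'.congr_fun (fun s hs => (gl' s hs.2).symm) measurableSet_Icc
    · exact (integrableOn_const (C := v) (by simp)).congr_fun
        (fun s hs => (gr' s hs.1).symm) measurableSet_Ioc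
  have i2 : IntegrableOn (fun u => Lfun G p (g u) (g' u)) (Icc 0 t') := by
    rw [hun]
    refine IntegrableOn.union ?_ ?_
    · exact hf.int_L.congr_fun (fun s hs => by simp only [gl s hs.2, gl' s hs.2]) measurableSet_Icc
    · refine IntegrableOn.congr_fun (f := fun u => Lfun G p (x + (u - t) * v) v) ?_
        (fun s hs => by simp only [gr s hs.1, gr' s hs.1]) measurableSet_Ioc
      refine Integrable.mono' (g := fun _ => K) (integrableOn_const (by simp)) ?_ ?_
      · exact ((h.L_meas v).comp (by fun_prop)).aestronglyMeasurable
      · refine Eventually.of_forall fun u => ?_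
        rw [Real.norm_of_nonneg (h.L_nonneg _ _)]
        exact h.L_le _ _
  have ii : ∀ {φ : ℝ → ℝ}, IntegrableOn φ (Icc 0 t') → ∀ {r s : ℝ}, r ∈ Icc 0 t' → s ∈ Icc 0 t' →
      IntervalIntegrable φ volume r s := by
    intro φ hφ r s hr hs
    refine IntegrableOn.intervalIntegrable (hφ.mono_set ?_)
    exact (convex_Icc 0 t').ordConnected.uIcc_subset hr hs
  have m0 : (0:ℝ) ∈ Icc 0 t' := ⟨le_rfl, by linarith⟩
  have mt : t ∈ Icc 0 t' := ⟨ht, htt.le⟩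
  have cong : ∀ {φ ψ : ℝ → ℝ}, (∀ s, s ≤ t → φ s = ψ s) → ∀ s ∈ Icc 0 t,
      ∫ u in (0:ℝ)..s, φ u = ∫ u in (0:ℝ)..s, ψ u := by
    intro φ ψ hh s hs
    refine intervalIntegral.integral_congr fun u hu => hh u ?_
    rw [uIcc_of_le hs.1] at hu
    exact hu.2.trans hs.2
  have acl : ∀ s ∈ Icc 0 t, g s = g 0 + ∫ u in (0:ℝ)..s, g' u := by
    intro s hs
    rw [gl s hs.2, gl 0 ht, cong gl' s hs]
    exact hf.ac s hs
  have ac : ∀ s ∈ Icc 0 t', g s = g 0 + ∫ u in (0:ℝ)..s, g' u := by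
    intro s hs
    rcases le_or_gt s t with hst | hst
    · exact acl s ⟨hs.1, hst⟩
    · rw [← intervalIntegral.integral_add_adjacent_intervals (ii i1 m0 mt) (ii i1 mt hs),
        ← add_assoc, ← acl t ⟨ht, le_rfl⟩, gl t le_rfl, hf.endpoint, gr s hst]
      congr 1
      rw [intervalIntegral.integral_congr_ae (g := fun _ => v)
        (Eventually.of_forall fun u hu => by rw [uIoc_of_le hst.le] at hu; exact gr' u hu.1)]
      simp
  have gc : ContinuousOn g (Icc 0 t') := by
    have h1 : ContinuousOn (fun s => g 0 + ∫ u in (0:ℝ)..s, g' u) (Icc 0 t') := by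
      refine continuousOn_const.add ?_
      have := intervalIntegral.continuousOn_primitive_interval (a := 0) (b := t') (f := g')
        (μ := volume) (by rw [uIcc_of_le m0.2]; exact i1)
      rwa [uIcc_of_le m0.2] at this
    exact h1.congr ac
  have i3 : IntegrableOn (fun u => Rfun b p d (g u)) (Icc 0 t') :=
    (h.Rc.comp_continuousOn gc).integrableOn_compact isCompact_Icc
  have Fl : ∀ s ∈ Icc 0 t, Ffun G p b d β₀ g g' s = Ffun G p b d β₀ f f' s := by
    intro s hs
    unfold Ffun
    rw [gl 0 ht, cong (φ := fun u => Rfun b p d (g u)) (ψ := fun u => Rfun b p d (f u))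
      (fun s hs => by simp only [gl s hs]) s hs,
      cong (φ := fun u => Lfun G p (g u) (g' u)) (ψ := fun u => Lfun G p (f u) (f' u))
      (fun s hs => by simp only [gl s hs, gl' s hs]) s hs]
  have Fr : ∀ s ∈ Icc 0 t', t < s →
      Ffun G p b d β₀ f f' t - e ≤ Ffun G p b d β₀ g g' s := by
    intro s hs hst
    rw [← Fl t ⟨ht, le_rfl⟩]
    unfold Ffun
    rw [← intervalIntegral.integral_add_adjacent_intervals (ii i3 m0 mt) (ii i3 mt hs),
      ← intervalIntegral.integral_add_adjacent_intervals (ii i2 m0 mt) (ii i2 mt hs)]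
    have b1 : ∫ u in t..s, (-M : ℝ) ≤ ∫ u in t..s, Rfun b p d (g u) :=
      intervalIntegral.integral_mono_on hst.le (by simp) (ii i3 mt hs) fun u _ => h.RM _
    have b2 : ∫ u in t..s, Lfun G p (g u) (g' u) ≤ ∫ u in t..s, K := by
      rw [intervalIntegral.integral_of_le hst.le, intervalIntegral.integral_of_le hst.le]
      refine setIntegral_mono_on (i2.mono_set (fun u hu => ⟨ht.trans hu.1.le, hu.2.trans hs.2⟩))
        (integrableOn_const (by simp)) measurableSet_Ioc fun u hu => ?_
      rw [gr' u hu.1]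
      exact h.L_le _ _
    simp only [intervalIntegral.integral_const, smul_eq_mul] at b1 b2
    have b3 : (s - t) * (M + K) ≤ (t' - t) * (M + K) := by
      gcongr; exact hs.2
    linarith
  refine ⟨g, g', ⟨i1, ac, i2, ?_, ?_⟩, Fr t' ⟨m0.2, le_rfl⟩ htt⟩
  · rw [gr t' htt, hv]; field_simp; ring
  · intro s hs
    rcases le_or_gt s t with hst | hst
    · rw [Fl s ⟨hs.1, hst⟩]; exact haa.trans (hf.constraint s ⟨hs.1, hst⟩)
    · exact hF.trans (Fr s hs hst)

lemma uval_anti (t x : ℝ) : Antitone fun a => uval G p b d β₀ a t x := by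
  intro a a' haa
  refine sSup_le_sSup ?_
  rintro z ⟨f, f', hf, rfl⟩
  exact ⟨f, f', hf.mono haa, rfl⟩

lemma OmTilde_anti {a a' : ℝ} (haa : a ≤ a') : OmTilde G p b d β₀ a' ⊆ OmTilde G p b d β₀ a := by
  rintro q ⟨h0, f, f', hf⟩
  exact ⟨h0, f, f', hf.mono haa⟩

lemma Hyp_s17.cone (h : Hyp_s17 G p b d c₀ pl pu M) {a : ℝ} {q : ℝ × ℝ} (hq : q ∈ Gam G p b d β₀ a) :
    ∀ᶠ δ in nhdsWithin (0:ℝ) (Ioi 0),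
      Metric.closedBall (q.1 + 2 * δ, q.2) δ ⊆ Gam G p b d β₀ a := by
  simp only [Gam, mem_iUnion, mem_Ioi, exists_prop] at hq
  obtain ⟨a₁, ha, h0, f, f', hf⟩ := hq
  set K := 1 / (4 * (pl * c₀)) with hK
  have hpl := h.hpl
  have hc₀ := h.hc₀
  have hM := h.hM
  have hKp : 0 < K := by positivity
  have hsm : ∀ᶠ δ in nhdsWithin (0:ℝ) (Ioi 0), 3 * δ * (M + K) < (a₁ - a) / 2 := by
    refine nhdsWithin_le_nhds ?_
    have : ContinuousAt (fun δ : ℝ => 3 * δ * (M + K)) 0 := by fun_prop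
    refine this.eventually_lt continuousAt_const ?_
    simp; exact ha
  filter_upwards [hsm, self_mem_nhdsWithin] with δ hδ hδ0
  have hδ0 : 0 < δ := hδ0
  rintro ⟨t', x'⟩ hq'
  rw [Metric.mem_closedBall, Prod.dist_eq, max_le_iff, Real.dist_eq, Real.dist_eq, abs_le, abs_le]
    at hq'
  obtain ⟨⟨h1, h2⟩, h3, h4⟩ := hq'
  simp only at h1 h2 h3 h4
  have htt : q.1 < t' := by linarith
  have hFt := hf.constraint q.1 ⟨h0, le_rfl⟩
  have hv : ((x' - q.2) / (t' - q.1)) ^ 2 ≤ 1 := by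
    rw [div_pow, div_le_one (by nlinarith)]
    nlinarith
  have hL : Lam (Hfun G) pl ((x' - q.2) / (t' - q.1)) ≤ K :=
    (Lam_le_sq hc₀ h.hH hpl _).trans (by rw [hK]; gcongr)
  obtain ⟨g, g', hg, -⟩ := h.extend (a' := (a + a₁) / 2) (x' := x') (e := (a₁ - a) / 2) h0 hf
    (by linarith) htt
    (by
      refine le_trans ?_ hδ.le
      have h5 : t' - q.1 ≤ 3 * δ := by linarith
      have h6 : M + Lam (Hfun G) pl ((x' - q.2) / (t' - q.1)) ≤ M + K := by linarith
      have h7 : 0 ≤ Lam (Hfun G) pl ((x' - q.2) / (t' - q.1)) :=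
        Lam_nonneg hc₀ h.hH h.H0 hpl _
      gcongr)
    (by linarith)
  simp only [Gam, mem_iUnion, mem_Ioi, exists_prop]
  exact ⟨(a + a₁) / 2, by linarith, h0.trans htt.le, g, g', hg⟩

lemma nullMeas_of_cone (S : Set (ℝ × ℝ))
    (hS : ∀ q ∈ S, ∀ᶠ δ in nhdsWithin (0:ℝ) (Ioi 0),
      Metric.closedBall (q.1 + 2 * δ, q.2) δ ⊆ S) : NullMeasurableSet S := by
  have hE : volume (S \ interior S) = 0 := by
    have h1 := IsUnifLocDoublingMeasure.ae_tendsto_measure_inter_div (volume : Measure (ℝ × ℝ))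
      (interior S)ᶜ 4
    rw [ae_restrict_iff' isOpen_interior.measurableSet.compl] at h1
    rw [measure_eq_zero_iff_ae_notMem]
    filter_upwards [h1] with q hq hqS
    have h2 := hq hqS.2 (ι := ℝ) (l := nhdsWithin (0:ℝ) (Ioi 0))
      (fun δ => (q.1 + 2 * δ, q.2)) (fun δ => δ / 2) ?_ ?_
    · have h3 : Tendsto (fun _ : ℝ => (0 : ENNReal)) (nhdsWithin (0:ℝ) (Ioi 0)) (nhds 1) := by
        refine h2.congr' ?_
        filter_upwards [hS q hqS.1, self_mem_nhdsWithin] with δ hδ hδ0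
        have hδ0 : 0 < δ := hδ0
        have h4 : (interior S)ᶜ ∩ Metric.closedBall (q.1 + 2 * δ, q.2) (δ / 2) = ∅ := by
          rw [← disjoint_iff_inter_eq_empty, disjoint_compl_left_iff_subset]
          refine (Metric.closedBall_subset_ball (by linarith : δ / 2 < δ)).trans ?_
          exact interior_maximal (Metric.ball_subset_closedBall.trans hδ) Metric.isOpen_ball
        rw [h4]; simp
      exact zero_ne_one (tendsto_nhds_unique tendsto_const_nhds h3)
    · refine tendsto_nhdsWithin_iff.2 ⟨?_, ?_⟩
      · refine Tendsto.mono_left ?_ nhdsWithin_le_nhds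
        have : ContinuousAt (fun δ : ℝ => δ / 2) 0 := by fun_prop
        simpa using this.tendsto
      · filter_upwards [self_mem_nhdsWithin] with δ hδ0
        exact half_pos (show 0 < δ from hδ0)
    · filter_upwards [self_mem_nhdsWithin] with δ hδ0
      have hδ0 : 0 < δ := hδ0
      rw [Metric.mem_closedBall, Prod.dist_eq, max_le_iff, Real.dist_eq, Real.dist_eq]
      simp only [sub_self, abs_zero]
      refine ⟨?_, by positivity⟩
      rw [abs_le]; constructor <;> linarith
  have : S = interior S ∪ (S \ interior S) := (union_sdiff_cancel interior_subset).symm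
  rw [this]
  exact isOpen_interior.measurableSet.nullMeasurableSet.union (NullMeasurableSet.of_null hE)

lemma Hyp_s17.part1 (h : Hyp_s17 G p b d c₀ pl pu M) :
    ∀ᵐ a₀ : ℝ ∂volume, (volume : Measure (ℝ × ℝ))
          (OmTilde G p b d β₀ a₀ \ Gam G p b d β₀ a₀) = 0 := by
  have hm : ∀ a, NullMeasurableSet (Gam G p b d β₀ a) := fun a =>
    nullMeas_of_cone _ fun q hq => h.cone hq
  let D : ℝ → Set (ℝ × ℝ) := fun a =>
    (⋂ n : ℕ, Gam G p b d β₀ (a - 1 / ((n:ℝ) + 1))) \ Gam G p b d β₀ a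
  have Dm : ∀ a, NullMeasurableSet (D a) := fun a =>
    (NullMeasurableSet.iInter fun n => hm _).diff (hm a)
  have ganti : ∀ a a', a ≤ a' → Gam G p b d β₀ a' ⊆ Gam G p b d β₀ a := by
    intro a a' haa
    exact biUnion_subset_biUnion_left (Ioi_subset_Ioi haa)
  have key : ∀ a a', a < a' → Disjoint (D a) (D a') := by
    intro a a' haa
    rw [Set.disjoint_left]
    rintro q ⟨-, hq⟩ ⟨hq', -⟩
    obtain ⟨n, hn⟩ := exists_nat_one_div_lt (sub_pos.2 haa)
    exact hq (ganti _ _ (by linarith) (mem_iInter.1 hq' n))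
  have hc := Measure.countable_meas_pos_of_disjoint_iUnion₀ (μ := volume) Dm (by
    intro a a' hne
    rcases lt_or_gt_of_ne hne with hl | hl
    · exact (key a a' hl).aedisjoint
    · exact (key a' a hl).symm.aedisjoint)
  filter_upwards [hc.ae_notMem volume] with a ha
  simp only [mem_ofPred_eq, not_lt, nonpos_iff_eq_zero] at ha
  refine measure_mono_null (sdiff_subset_sdiff_left ?_) ha
  intro q hq
  refine mem_iInter.2 fun n => ?_
  simp only [Gam, mem_iUnion, mem_Ioi, exists_prop]
  refine ⟨a, ?_, hq⟩
  have : (0:ℝ) < 1 / ((n:ℝ) + 1) := by positivity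
  linarith

lemma Hyp_s17.line_cost (h : Hyp_s17 G p b d c₀ pl pu M) {a t x s : ℝ} {f f' : ℝ → ℝ} (hs : 0 ≤ s)
    (hst : s < t) (hf : Admissible G p b d β₀ a t x f f') :
    (t - s) * Lam (Hfun G) pu ((x - f s) / (t - s)) ≤
      ∫ u in s..t, Lfun G p (f u) (f' u) := by
  have hts : 0 < t - s := by linarith
  rw [← le_div_iff₀' hts]
  refine ciSup_le fun α => ?_
  rw [le_div_iff₀' hts]
  have ii : ∀ {φ : ℝ → ℝ}, IntegrableOn φ (Icc 0 t) → ∀ {r s : ℝ}, r ∈ Icc 0 t → s ∈ Icc 0 t →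
      IntervalIntegrable φ volume r s := by
    intro φ hφ r s hr hs
    refine IntegrableOn.intervalIntegrable (hφ.mono_set ?_)
    exact (convex_Icc 0 t).ordConnected.uIcc_subset hr hs
  have m0 : (0:ℝ) ∈ Icc 0 t := ⟨le_rfl, by linarith⟩
  have ms : s ∈ Icc 0 t := ⟨hs, hst.le⟩
  have mt : t ∈ Icc 0 t := ⟨m0.2, le_rfl⟩
  have e1 : ∫ u in s..t, f' u = x - f s := by
    have h1 := hf.ac t mt
    have h2 := hf.ac s ms
    have h3 := intervalIntegral.integral_add_adjacent_intervals (ii hf.int_f' m0 ms)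
      (ii hf.int_f' ms mt)
    rw [hf.endpoint] at h1
    linarith
  have e2 : ∫ u in s..t, (α * f' u - pu * Hfun G α) = α * (x - f s) - (t - s) * (pu * Hfun G α) := by
    rw [intervalIntegral.integral_sub ((ii hf.int_f' ms mt).const_mul _) (by simp),
      intervalIntegral.integral_const_mul, e1, intervalIntegral.integral_const, smul_eq_mul]
  calc (t - s) * (α * ((x - f s) / (t - s)) - pu * Hfun G α)
      = α * (x - f s) - (t - s) * (pu * Hfun G α) := by field_simp
    _ = ∫ u in s..t, (α * f' u - pu * Hfun G α) := e2.symm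
    _ ≤ _ := intervalIntegral.integral_mono_on hst.le
        (((ii hf.int_f' ms mt).const_mul _).sub (by simp)) (ii hf.int_L ms mt)
        fun u _ => h.le_L _ _ _

lemma Hyp_s17.part2 (h : Hyp_s17 G p b d c₀ pl pu M) {a₀ : ℝ}
    (hN : ∀ q : ℚ × ℚ, ContinuousAt (fun a => uval G p b d β₀ a (q.1 : ℝ) (q.2 : ℝ)) a₀)
    {t x r : ℝ} (ht : 0 < t) (har : a₀ < r)
    {f f' : ℝ → ℝ} (hf : Admissible G p b d β₀ a₀ t x f f') (hr : r < Ffun G p b d β₀ f f' t) :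
    ∀ᶠ a in nhdsWithin a₀ (Ioi a₀), (r : EReal) < uval G p b d β₀ a t x := by
  obtain ⟨K, hK, hcomp⟩ := Lam_compare h.hc₀ h.hH h.H2 h.hpl
    (h.hpl.trans_le ((h.hp 0).1.trans (h.hp 0).2))
  set η := Ffun G p b d β₀ f f' t - r with hη
  have hη0 : 0 < η := by linarith
  have mt : t ∈ Icc 0 t := ⟨ht.le, le_rfl⟩
  have m0 : (0:ℝ) ∈ Icc 0 t := ⟨le_rfl, ht.le⟩
  have prim : ∀ {φ : ℝ → ℝ}, IntegrableOn φ (Icc 0 t) →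
      ContinuousOn (fun s => ∫ u in (0:ℝ)..s, φ u) (Icc 0 t) := by
    intro φ hφ
    have := intervalIntegral.continuousOn_primitive_interval (a := 0) (b := t) (f := φ)
      (μ := volume) (by rw [uIcc_of_le ht.le]; exact hφ)
    rwa [uIcc_of_le ht.le] at this
  have iR : IntegrableOn (fun u => Rfun b p d (f u)) (Icc 0 t) :=
    (h.Rc.comp_continuousOn (hf.contOn ht.le)).integrableOn_compact isCompact_Icc
  have cL := prim hf.int_L
  have cF : ContinuousOn (Ffun G p b d β₀ f f') (Icc 0 t) :=
    (continuousOn_const.add (prim iR)).sub cL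
  have hle : nhdsWithin t (Ico 0 t) ≤ nhdsWithin t (Icc 0 t) := nhdsWithin_mono _ Ico_subset_Icc_self
  have ev1 : ∀ᶠ s in nhdsWithin t (Ico 0 t),
      Ffun G p b d β₀ f f' t - η / 4 < Ffun G p b d β₀ f f' s :=
    hle ((cF t mt).eventually (lt_mem_nhds (by linarith)))
  have ev2 : ∀ᶠ s in nhdsWithin t (Ico 0 t),
      (t - s) * (M + 1) + K * ((∫ u in (0:ℝ)..t, Lfun G p (f u) (f' u)) -
        ∫ u in (0:ℝ)..s, Lfun G p (f u) (f' u)) < η / 4 := by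
    have c : ContinuousOn (fun s => (t - s) * (M + 1) +
      K * ((∫ u in (0:ℝ)..t, Lfun G p (f u) (f' u)) -
        ∫ u in (0:ℝ)..s, Lfun G p (f u) (f' u))) (Icc 0 t) := by
      refine ContinuousOn.add (by fun_prop) (continuousOn_const.mul (continuousOn_const.sub cL))
    refine hle ((c t mt).eventually (gt_mem_nhds ?_))
    simp; linarith
  have hne : (nhdsWithin t (Ico 0 t)).NeBot := by
    rw [← mem_closure_iff_nhdsWithin_neBot, closure_Ico ht.ne]; exact mt
  obtain ⟨s, ⟨hs1, hs2⟩, hs0, hst⟩ := ((ev1.and ev2).and self_mem_nhdsWithin).exists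
  have ms : s ∈ Icc 0 t := ⟨hs0, hst.le⟩
  have hts : 0 < t - s := by linarith
  set v := (x - f s) / (t - s) with hv
  have hcost : (t - s) * (M + (Lam (Hfun G) pl v + 1)) < η / 4 := by
    have h1 := h.line_cost hs0 hst hf
    have h2 : ∫ u in s..t, Lfun G p (f u) (f' u) = (∫ u in (0:ℝ)..t, Lfun G p (f u) (f' u)) -
        ∫ u in (0:ℝ)..s, Lfun G p (f u) (f' u) := by
      rw [intervalIntegral.integral_interval_sub_left]
      · exact (hf.int_L.mono_set (by rw [uIcc_of_le ht.le])).intervalIntegrable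
      · exact (hf.int_L.mono_set (by rw [uIcc_of_le hs0]; exact Icc_subset_Icc_right hst.le)).intervalIntegrable
    rw [← h2] at hs2
    have h3 : (t - s) * Lam (Hfun G) pl v ≤ (t - s) * (K * Lam (Hfun G) pu v) := by
      gcongr; exact hcomp v
    have h4 : K * ((t - s) * Lam (Hfun G) pu v) ≤ K * ∫ u in s..t, Lfun G p (f u) (f' u) := by
      gcongr
    linarith
  -- rational point near the midpoint
  have hLc := Lam_cont h.hc₀ h.hH h.hpl
  set m : ℝ × ℝ := ((s + t) / 2, (f s + x) / 2) with hm
  have n1 : ∀ᶠ q : ℝ × ℝ in nhds m, s < q.1 ∧ q.1 < t ∧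
      Lam (Hfun G) pl ((q.2 - f s) / (q.1 - s)) < Lam (Hfun G) pl v + 1 ∧
      Lam (Hfun G) pl ((x - q.2) / (t - q.1)) < Lam (Hfun G) pl v + 1 := by
    have w1 : (m.2 - f s) / (m.1 - s) = v := by
      rw [hv, div_eq_div_iff (by simp only [hm]; linarith) hts.ne']; simp only [hm]; ring
    have w2 : (x - m.2) / (t - m.1) = v := by
      rw [hv, div_eq_div_iff (by simp only [hm]; linarith) hts.ne']; simp only [hm]; ring
    refine (continuousAt_const.eventually_lt continuousAt_fst (by simp only [hm]; linarith)).and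
      ((continuousAt_fst.eventually_lt continuousAt_const (by simp only [hm]; linarith)).and
      (Filter.Eventually.and ?_ ?_))
    · have : ContinuousAt (fun q : ℝ × ℝ => Lam (Hfun G) pl ((q.2 - f s) / (q.1 - s))) m := by
        refine hLc.continuousAt.comp (ContinuousAt.div (by fun_prop) (by fun_prop) ?_)
        simp only [hm]; linarith
      refine this.eventually_lt continuousAt_const ?_
      rw [w1]; linarith
    · have : ContinuousAt (fun q : ℝ × ℝ => Lam (Hfun G) pl ((x - q.2) / (t - q.1))) m := by
        refine hLc.continuousAt.comp (ContinuousAt.div (by fun_prop) (by fun_prop) ?_)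
        simp only [hm]; linarith
      refine this.eventually_lt continuousAt_const ?_
      rw [w2]; linarith
  have hdense : DenseRange (Prod.map ((↑) : ℚ → ℝ) ((↑) : ℚ → ℝ)) :=
    Rat.denseRange_cast.prodMap Rat.denseRange_cast
  obtain ⟨U, hU, hUo, hmU⟩ := eventually_nhds_iff.1 n1
  obtain ⟨q, hq⟩ := hdense.exists_mem_open hUo ⟨m, hmU⟩
  obtain ⟨q1, q2, q3, q4⟩ := hU _ hq
  simp only [Prod.map_fst, Prod.map_snd] at q1 q2 q3 q4
  have hM := h.hM
  have hLv := Lam_nonneg h.hc₀ h.hH h.H0 h.hpl v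
  have cost : ∀ τ w : ℝ, 0 < τ → τ ≤ t - s → Lam (Hfun G) pl w < Lam (Hfun G) pl v + 1 →
      τ * (M + Lam (Hfun G) pl w) ≤ η / 4 := by
    intro τ w hτ hτ' hw
    refine le_trans ?_ hcost.le
    have := Lam_nonneg h.hc₀ h.hH h.H0 h.hpl w
    gcongr
  obtain ⟨g, g', hg, hgF⟩ := h.extend (a' := a₀) (t' := (q.1 : ℝ)) (x' := (q.2 : ℝ)) (e := η / 4)
    hs0 (hf.restrict ms) le_rfl q1 (cost _ _ (by linarith) (by linarith) q3) (by linarith)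
  have hu : ((r + η / 2 : ℝ) : EReal) < uval G p b d β₀ a₀ (q.1 : ℝ) (q.2 : ℝ) := by
    refine lt_of_lt_of_le (EReal.coe_lt_coe_iff.2 ?_) (le_sSup ⟨g, g', hg, rfl⟩)
    linarith
  have ev3 := (hN q).eventually (lt_mem_nhds hu)
  filter_upwards [nhdsWithin_le_nhds ev3, nhdsWithin_le_nhds (gt_mem_nhds har),
    self_mem_nhdsWithin] with a ha1 ha2 ha3
  obtain ⟨z, ⟨k, k', hk, rfl⟩, hz⟩ := lt_sSup_iff.1 ha1
  rw [EReal.coe_lt_coe_iff] at hz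
  obtain ⟨l, l', hl, hlF⟩ := h.extend (a' := a) (t' := t) (x' := x) (e := η / 4)
    (by linarith) hk le_rfl q2 (cost _ _ (by linarith) (by linarith) q4) (by linarith)
  refine lt_of_lt_of_le (EReal.coe_lt_coe_iff.2 ?_) (le_sSup ⟨l, l', hl, rfl⟩)
  linarith

end main

/-- For Lebesgue-a.e. `a₀ ∈ ℝ`: (i) `Ω̃_{a₀} \ Γ_{a₀}` is Lebesgue-null in
`[0,∞)×ℝ`; (ii) for every `(t,x) ∈ Γ_{a₀} ∪ (([0,∞)×ℝ) \ Ω̃_{a₀})` one has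
`u_a(t,x) → u_{a₀}(t,x)` in `[−∞,∞]` as `a ↓ a₀` (with `u_a(t,x) = −∞` when
`(t,x) ∉ Ω̃_a`, as is automatic from the `sup ∅ = ⊥` convention). -/
theorem stmt17 (G p b d β₀ : ℝ → ℝ)
    (hGcont : Continuous G) (hGpos : ∀ y, 0 < G y) (hGeven : ∀ y, G (-y) = G y)
    (hGint : Integrable G) (hGprob : ∫ y : ℝ, G y = 1)
    (hGexp : ∀ α : ℝ, Integrable (fun y => Real.exp (α * y) * G y))
    (hpLip : LocallyLipschitz p)
    (pl pu : ℝ) (hpl : 0 < pl) (hp : ∀ x, pl ≤ p x ∧ p x ≤ pu)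
    (hb : ∀ x, 0 ≤ b x) (hbBdd : ∃ Cb, ∀ x, b x ≤ Cb) (hbLip : LocallyLipschitz b)
    (hd : ∀ x, 0 ≤ d x) (hdBdd : ∃ Cd, ∀ x, d x ≤ Cd) (hdLip : LocallyLipschitz d)
    (Rbar : ℝ) (hR : ∀ x, Rfun b p d x ≤ Rbar)
    (hβLip : LocallyLipschitz β₀)
    (βbar α₀ : ℝ) (hα₀ : 0 < α₀) (hβ : ∀ x, β₀ x ≤ βbar - α₀ * |x|) :
    ∀ᵐ a₀ : ℝ ∂volume,
      (volume : Measure (ℝ × ℝ))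
          (OmTilde G p b d β₀ a₀ \ Gam G p b d β₀ a₀) = 0 ∧
      ∀ q : ℝ × ℝ,
        q ∈ Gam G p b d β₀ a₀ ∪ ({q : ℝ × ℝ | 0 ≤ q.1} \ OmTilde G p b d β₀ a₀) →
        Tendsto (fun a => uval G p b d β₀ a q.1 q.2)
          (nhdsWithin a₀ (Ioi a₀)) (nhds (uval G p b d β₀ a₀ q.1 q.2)) := by
  obtain ⟨H0, ⟨c₀, hc₀, hH⟩, H2⟩ := Hfun_facts G hGcont hGpos hGeven hGint hGexp
  obtain ⟨Cd, hCd⟩ := hdBdd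
  have h : Hyp_s17 G p b d c₀ pl pu Cd :=
    { hc₀ := hc₀, H0 := H0, hH := hH, H2 := H2, hpl := hpl, hp := hp, pc := hpLip.continuous
      Rc := (hbLip.continuous.add hpLip.continuous).sub hdLip.continuous
      hM := (hd 0).trans (hCd 0)
      RM := fun x => by
        have h1 := hb x
        have h2 := hp x
        have h3 := hCd x
        unfold Rfun; linarith [h2.1] }
  have hN : ∀ᵐ a₀ : ℝ ∂volume, ∀ q : ℚ × ℚ,
      ContinuousAt (fun a => uval G p b d β₀ a (q.1 : ℝ) (q.2 : ℝ)) a₀ := by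
    rw [ae_all_iff]
    intro q
    filter_upwards [(uval_anti (G := G) (p := p) (b := b) (d := d) (β₀ := β₀)
      (q.1 : ℝ) (q.2 : ℝ)).countable_not_continuousAt.ae_notMem volume] with a ha
    simpa using ha
  filter_upwards [h.part1 (β₀ := β₀), hN] with a₀ h1 hN
  refine ⟨h1, ?_⟩
  rintro ⟨t, x⟩ hq
  simp only
  rcases hq with hq | ⟨hq0, hq⟩
  · refine tendsto_order.2 ⟨fun z hz => ?_, fun z hz => ?_⟩
    · simp only [Gam, mem_iUnion, mem_Ioi, exists_prop] at hq
      obtain ⟨a₁, ha, h0, f, f', hf⟩ := hq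
      simp only at h0 hf
      have hF1 := hf.constraint t ⟨h0, le_rfl⟩
      rcases h0.eq_or_lt with rfl | ht
      · filter_upwards [nhdsWithin_le_nhds (gt_mem_nhds ha)] with a ha'
        refine lt_of_lt_of_le hz (sSup_le ?_)
        rintro _ ⟨g, g', hg, rfl⟩
        refine le_sSup ⟨f, f', hf.mono (le_of_lt ha'), ?_⟩
        simp [Ffun, hf.endpoint, hg.endpoint]
      · have hz' : max z (((a₀ + a₁) / 2 : ℝ) : EReal) < uval G p b d β₀ a₀ t x := by
          refine max_lt hz ?_
          refine lt_of_lt_of_le (EReal.coe_lt_coe_iff.2 ?_)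
            (le_sSup ⟨f, f', hf.mono ha.le, rfl⟩)
          linarith
        obtain ⟨_, ⟨g, g', hg, rfl⟩, hlt⟩ := lt_sSup_iff.1 hz'
        obtain ⟨r, hr1, hr2⟩ := EReal.lt_iff_exists_real_btwn.1 hlt
        have hr3 := (le_max_right _ _).trans_lt hr1
        rw [EReal.coe_lt_coe_iff] at hr3 hr2
        filter_upwards [h.part2 hN ht (by linarith) hg hr2] with a ha
        exact ((le_max_left _ _).trans_lt hr1).trans ha
    · filter_upwards [self_mem_nhdsWithin] with a ha
      exact lt_of_le_of_lt (uval_anti t x (le_of_lt ha)) hz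
  · have hbot : ∀ a, a₀ ≤ a → uval G p b d β₀ a t x = ⊥ := by
      intro a ha
      rw [eq_bot_iff]
      refine sSup_le ?_
      rintro _ ⟨g, g', hg, rfl⟩
      exact absurd ⟨hq0, g, g', hg.mono ha⟩ hq
    rw [hbot a₀ le_rfl]
    refine tendsto_const_nhds.congr' ?_
    filter_upwards [self_mem_nhdsWithin] with a ha
    exact (hbot a (le_of_lt ha)).symm
end
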